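/- arXiv:0910.1176 — 3 statements merged into one kernel-verified Lean document; each statement's English description precedes it below -/
import Mathlib

section
/- Let N ≥ 2 and 1 ≤ k ≤ N be integers, and for j = 1,…,N let D_j ⊆ ℂ^{n_j} be a nonempty open connected set. Let f : D_1 × ⋯ × D_N → ℂ be a function such that for every point a = (a_1,…,a_N) ∈ D_1 × ⋯ × D_N and every subset S ⊆ {1,…,N} with |S| = k, the map ∏_{j∈S} D_j ∋ (z_j)_{j∈S} ↦ f(w), where w_j = z_j for j ∈ S and w_j = a_j for j ∉ S, is holomorphic on ∏_{j∈S} D_j. Then f is holomorphic on D_1 × ⋯ × D_N. (This is the cross theorem for (N,k)-crosses in the case A_j = D_j; for k = 1 it is Hartogs' theorem on separate holomorphy.) -/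
section

open Metric Set MeasureTheory Filter Topology

theorem norm_sub_le_of_bounded_holomorphic {E : Type*} [NormedAddCommGroup E] [NormedSpace ℂ E]
    {g : E → ℂ} {c z : E} {r M : ℝ} (hg : DifferentiableOn ℂ g (ball c r))
    (hM : ∀ x ∈ ball c r, ‖g x‖ ≤ M) (hz : z ∈ ball c r) :
    ‖g z - g c‖ ≤ 2 * M / r * ‖z - c‖ := by
  have hr : 0 < r := pos_of_mem_ball hz
  have := Complex.dist_le_div_mul_dist_of_mapsTo_ball (R₂ := 2 * M) hg (fun x hx => by
    rw [mem_closedBall, dist_eq_norm]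
    linarith [norm_sub_le (g x) (g c), hM x hx, hM c (mem_ball_self hr)]) hz
  simpa [dist_eq_norm] using this

/-- For a locally bounded separately holomorphic function, the partial derivatives are jointly
continuous. -/
theorem continuousAt_fderiv_of_separately_holomorphic {E F : Type*}
    [NormedAddCommGroup E] [NormedSpace ℂ E] [NormedAddCommGroup F] [NormedSpace ℂ F]
    {f : E → F → ℂ} {z₀ : E} {w₀ : F} {r M : ℝ} (hr : 0 < r)
    (hz : ∀ w ∈ ball w₀ r, DifferentiableOn ℂ (fun z => f z w) (ball z₀ r))
    (hw : ∀ z ∈ ball z₀ r, DifferentiableOn ℂ (f z) (ball w₀ r))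
    (hM : ∀ z ∈ ball z₀ r, ∀ w ∈ ball w₀ r, ‖f z w‖ ≤ M) :
    ContinuousAt (fun p : E × F => fderiv ℂ (f p.1) p.2) (z₀, w₀) := by
  have hM0 : 0 ≤ M := (norm_nonneg _).trans (hM z₀ (mem_ball_self hr) w₀ (mem_ball_self hr))
  set C : ℝ := 2 * (2 * M / r + 2 * M / (r / 2)) / (r / 2) with hC
  have key : ∀ p ∈ ball (z₀, w₀) (r / 2),
      dist (fderiv ℂ (f p.1) p.2) (fderiv ℂ (f z₀) w₀) ≤ C * dist p (z₀, w₀) := by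
    rintro ⟨z, w⟩ hp
    set d := dist (z, w) (z₀, w₀) with hd
    have hd' : d < r / 2 := hp
    have hdz : ‖z - z₀‖ ≤ d := by
      rw [hd, ← dist_eq_norm, Prod.dist_eq]; exact le_max_left _ _
    have hdw : ‖w - w₀‖ ≤ d := by
      rw [hd, ← dist_eq_norm, Prod.dist_eq]; exact le_max_right _ _
    have hzmem : z ∈ ball z₀ r := by rw [mem_ball, dist_eq_norm]; linarith
    have hz₀ : z₀ ∈ ball z₀ r := mem_ball_self hr
    have hw₀h : ∀ h ∈ ball (0 : F) (r / 2), w₀ + h ∈ ball w₀ r := by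
      intro h hh
      rw [mem_ball_zero_iff] at hh
      rw [mem_ball, dist_eq_norm]; simp; linarith
    have hwh : ∀ h ∈ ball (0 : F) (r / 2), w + h ∈ ball w₀ r := by
      intro h hh
      rw [mem_ball_zero_iff] at hh
      rw [mem_ball, dist_eq_norm]
      have : w + h - w₀ = (w - w₀) + h := by abel
      rw [this]
      linarith [norm_add_le (w - w₀) h]
    set g : F → ℂ := fun h => f z (w + h) - f z₀ (w₀ + h) with hg
    have hgd : DifferentiableOn ℂ g (ball 0 (r / 2)) := by
      apply DifferentiableOn.sub
      · exact (hw z hzmem).comp (by fun_prop) hwh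
      · exact (hw z₀ hz₀).comp (by fun_prop) hw₀h
    have hgb : ∀ h ∈ ball (0 : F) (r / 2), ‖g h‖ ≤ (2 * M / r + 2 * M / (r / 2)) * d := by
      intro h hh
      have e1 := norm_sub_le_of_bounded_holomorphic (hz _ (hwh h hh))
        (fun x hx => hM x hx _ (hwh h hh)) hzmem
      have hsub : ball (w₀ + h) (r / 2) ⊆ ball w₀ r := by
        apply ball_subset_ball'
        rw [mem_ball_zero_iff] at hh
        simp [dist_eq_norm]; linarith
      have e2 := norm_sub_le_of_bounded_holomorphic (z := w + h) ((hw z₀ hz₀).mono hsub)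
        (fun x hx => hM z₀ hz₀ _ (hsub hx)) (by rw [mem_ball, dist_eq_norm]; simp; linarith)
      have e3 : (w + h) - (w₀ + h) = w - w₀ := by abel
      rw [e3] at e2
      have e4 : g h = (f z (w + h) - f z₀ (w + h)) + (f z₀ (w + h) - f z₀ (w₀ + h)) := by
        simp [hg]
      rw [e4, add_mul]
      refine (norm_add_le _ _).trans (add_le_add (e1.trans ?_) (e2.trans ?_)) <;> gcongr
    have hder : fderiv ℂ g 0 = fderiv ℂ (f z) w - fderiv ℂ (f z₀) w₀ := by
      have h0 : (0 : F) ∈ ball (0 : F) (r / 2) := mem_ball_self (by linarith)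
      have d1 : DifferentiableAt ℂ (f z) (w + 0) :=
        (hw z hzmem).differentiableAt (isOpen_ball.mem_nhds (hwh 0 h0))
      have d2 : DifferentiableAt ℂ (f z₀) (w₀ + 0) :=
        (hw z₀ hz₀).differentiableAt (isOpen_ball.mem_nhds (hw₀h 0 h0))
      have c1 : DifferentiableAt ℂ (fun h => f z (w + h)) 0 := d1.comp 0 (by fun_prop)
      have c2 : DifferentiableAt ℂ (fun h => f z₀ (w₀ + h)) 0 := d2.comp 0 (by fun_prop)
      rw [hg, fderiv_fun_sub c1 c2, fderiv_comp_add_left, fderiv_comp_add_left]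
      simp
    have hbound := Complex.norm_fderiv_le_div_of_mapsTo_ball (c := (0 : F))
      (R₂ := 2 * ((2 * M / r + 2 * M / (r / 2)) * d)) hgd (fun x hx => by
        rw [mem_closedBall, dist_eq_norm]
        linarith [norm_sub_le (g x) (g 0), hgb x hx,
          hgb 0 (mem_ball_self (by linarith))]) (by linarith)
    rw [dist_eq_norm, ← hder]
    refine hbound.trans (le_of_eq ?_)
    rw [hC]; ring
  have hlim : Tendsto (fun p : E × F => C * dist p (z₀, w₀)) (𝓝 (z₀, w₀)) (𝓝 0) := by
    have : Continuous (fun p : E × F => C * dist p (z₀, w₀)) := by fun_prop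
    simpa using this.tendsto (z₀, w₀)
  rw [ContinuousAt, tendsto_iff_dist_tendsto_zero]
  refine squeeze_zero' (Eventually.of_forall fun _ => dist_nonneg) ?_ hlim
  filter_upwards [ball_mem_nhds (z₀, w₀) (half_pos hr)] with p hp using key p hp

/-- **Osgood's lemma**: a bounded separately holomorphic function is holomorphic. -/
theorem differentiableAt_of_bounded_separately_holomorphic {E F : Type*}
    [NormedAddCommGroup E] [NormedSpace ℂ E] [NormedAddCommGroup F] [NormedSpace ℂ F]
    {f : E → F → ℂ} {z₀ : E} {w₀ : F} {r M : ℝ} (hr : 0 < r)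
    (hz : ∀ w ∈ ball w₀ r, DifferentiableOn ℂ (fun z => f z w) (ball z₀ r))
    (hw : ∀ z ∈ ball z₀ r, DifferentiableOn ℂ (f z) (ball w₀ r))
    (hM : ∀ z ∈ ball z₀ r, ∀ w ∈ ball w₀ r, ‖f z w‖ ≤ M) :
    DifferentiableAt ℂ (fun p : E × F => f p.1 p.2) (z₀, w₀) := by
  have hmem : ∀ᶠ p : E × F in 𝓝 (z₀, w₀), p.1 ∈ ball z₀ r ∧ p.2 ∈ ball w₀ r := by
    filter_upwards [prod_mem_nhds (ball_mem_nhds z₀ hr) (ball_mem_nhds w₀ hr)] with p hp using hp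
  have h₁ := continuousAt_fderiv_of_separately_holomorphic hr hz hw hM
  have h₂ := continuousAt_fderiv_of_separately_holomorphic (f := fun w z => f z w) hr hw hz
    (fun w hw z hz => hM z hz w hw)
  have h₂' : ContinuousAt (fun p : E × F => fderiv ℂ (fun z => f z p.2) p.1) (z₀, w₀) :=
    ContinuousAt.comp' (f := Prod.swap) (x := (z₀, w₀)) h₂ continuous_swap.continuousAt
  exact (hasStrictFDerivAt_uncurry_coprod (u := (z₀, w₀)) (f := f)
    (f₁ := fun z w => fderiv ℂ (fun z => f z w) z) (f₂ := fun z w => fderiv ℂ (f z) w)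
    (hmem.mono fun p hp => ((hz p.2 hp.2).differentiableAt
      (isOpen_ball.mem_nhds hp.1)).hasFDerivAt)
    (hmem.mono fun p hp => ((hw p.1 hp.1).differentiableAt
      (isOpen_ball.mem_nhds hp.2)).hasFDerivAt) h₂' h₁).hasFDerivAt.differentiableAt

/-- Taylor coefficients in one variable of a bounded separately holomorphic function are
holomorphic in the other variable. -/
theorem differentiableOn_iteratedDeriv_of_separately_holomorphic {h : ℂ → ℂ → ℂ} {w₀ : ℂ}
    {δ R M : ℝ} (hδ : 0 < δ)
    (ht : ∀ w ∈ ball w₀ R, DifferentiableOn ℂ (fun t => h t w) (ball 0 δ))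
    (hw : ∀ t ∈ ball (0 : ℂ) δ, DifferentiableOn ℂ (h t) (ball w₀ R))
    (hM : ∀ t ∈ ball (0 : ℂ) δ, ∀ w ∈ ball w₀ R, ‖h t w‖ ≤ M) (k : ℕ) :
    DifferentiableOn ℂ (fun w => iteratedDeriv k (fun t => h t w) 0) (ball w₀ R) := by
  set r := δ / 2 with hr
  have hr0 : 0 < r := by linarith
  have hrδ : r < δ := by linarith
  have hmem : ∀ θ, circleMap 0 r θ ∈ ball (0 : ℂ) δ := fun θ => by
    simp [abs_of_pos hr0, hrδ]
  have hne : ∀ θ, circleMap 0 r θ ≠ 0 := fun θ => circleMap_ne_center hr0.ne'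
  set F : ℂ → ℝ → ℂ := fun w θ => deriv (circleMap 0 r) θ •
    (1 / (circleMap 0 r θ - 0) ^ (k + 1)) • h (circleMap 0 r θ) w with hF
  have hcoef : Continuous fun θ => deriv (circleMap 0 r) θ *
      (1 / (circleMap 0 r θ - 0) ^ (k + 1)) := by
    simp only [deriv_circleMap, sub_zero]
    refine Continuous.mul (by fun_prop) (Continuous.div (by fun_prop) (by fun_prop) ?_)
    exact fun θ => pow_ne_zero _ (hne θ)
  have heq : ∀ w ∈ ball w₀ R, iteratedDeriv k (fun t => h t w) 0 =
      (2 * Real.pi * Complex.I / k.factorial)⁻¹ • ∫ θ in 0..2 * Real.pi, F w θ := by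
    intro w hw'
    have := DiffContOnCl.circleIntegral_one_div_sub_center_pow_smul hr0 k
      (((ht w hw').mono (closedBall_subset_ball hrδ)).diffContOnCl_ball subset_rfl)
    rw [circleIntegral] at this
    rw [hF, this, inv_smul_smul₀]
    simp [Nat.factorial_ne_zero, Real.pi_ne_zero]
  have hcontF : ∀ w ∈ ball w₀ R, Continuous (F w) := by
    intro w hw'
    simp only [hF, smul_eq_mul, ← mul_assoc]
    exact hcoef.mul ((ht w hw').continuousOn.comp_continuous (continuous_circleMap 0 r) hmem)
  suffices H : DifferentiableOn ℂ (fun w => ∫ θ in 0..2 * Real.pi, F w θ) (ball w₀ R) from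
    (H.const_smul (2 * Real.pi * Complex.I / k.factorial : ℂ)⁻¹).congr heq
  intro w hw'
  apply DifferentiableAt.differentiableWithinAt
  obtain ⟨ε, hε, hεR⟩ := isOpen_iff.1 (isOpen_ball (x := w₀) (ε := R)) w hw'
  obtain ⟨C, hC⟩ : ∃ C, ∀ θ, ‖deriv (circleMap 0 r) θ * (1 / (circleMap 0 r θ - 0) ^ (k + 1))‖ ≤ C :=
    ⟨r * (1 / r ^ (k + 1)), fun θ => by simp [abs_of_pos hr0]⟩
  have hC0 : 0 ≤ C := (norm_nonneg _).trans (hC 0)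
  have hderivcont : Continuous fun θ => deriv (h (circleMap 0 r θ)) w := by
    rw [continuous_iff_continuousAt]
    intro θ
    obtain ⟨ε', hε', hεδ⟩ := isOpen_iff.1 (isOpen_ball (x := (0 : ℂ)) (ε := δ)) _ (hmem θ)
    have h1 : ball w (min ε ε') ⊆ ball w₀ R := (ball_subset_ball (min_le_left _ _)).trans hεR
    have h2 : ball (circleMap 0 r θ) (min ε ε') ⊆ ball 0 δ :=
      (ball_subset_ball (min_le_right _ _)).trans hεδ
    have h3 := continuousAt_fderiv_of_separately_holomorphic (f := h) (z₀ := circleMap 0 r θ)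
      (w₀ := w) (lt_min hε hε') (fun w hw => (ht w (h1 hw)).mono h2)
      (fun z hz => (hw z (h2 hz)).mono h1) (fun z hz w hw => hM z (h2 hz) w (h1 hw))
    have h4 : ContinuousAt (fun θ => fderiv ℂ (h (circleMap 0 r θ)) w) θ :=
      ContinuousAt.comp' (f := fun θ => (circleMap 0 r θ, w)) (x := θ) h3
        (by fun_prop)
    exact h4.clm_apply continuousAt_const
  refine (intervalIntegral.hasDerivAt_integral_of_dominated_loc_of_deriv_le
    (F := F) (F' := fun w θ => deriv (circleMap 0 r) θ •
    (1 / (circleMap 0 r θ - 0) ^ (k + 1)) • deriv (h (circleMap 0 r θ)) w)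
    (bound := fun _ => C * (M / (ε / 2))) (s := ball w (ε / 2))
    (ball_mem_nhds _ (half_pos hε)) ?_ ?_ ?_ ?_ ?_ ?_).2.differentiableAt
  · filter_upwards [isOpen_ball.mem_nhds hw'] with x hx
    exact (hcontF x hx).aestronglyMeasurable
  · exact (hcontF w hw').intervalIntegrable _ _
  · simp only [smul_eq_mul, ← mul_assoc]
    exact (hcoef.mul hderivcont).aestronglyMeasurable
  · refine Eventually.of_forall fun θ _ x hx => ?_
    rw [smul_eq_mul, smul_eq_mul, ← mul_assoc, norm_mul]
    have hsub : closedBall x (ε / 2) ⊆ ball w₀ R := fun y hy => hεR (by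
      rw [mem_ball] at hx ⊢; rw [mem_closedBall] at hy; linarith [dist_triangle y x w])
    have := Complex.norm_deriv_le_of_forall_mem_sphere_norm_le (half_pos hε)
      (((hw _ (hmem θ)).mono hsub).diffContOnCl_ball subset_rfl)
      (fun z hz => hM _ (hmem θ) z (hsub (sphere_subset_closedBall hz)))
    exact mul_le_mul (hC θ) this (norm_nonneg _) hC0
  · exact intervalIntegrable_const
  · refine Eventually.of_forall fun θ _ x hx => ?_
    have hx' : x ∈ ball w₀ R := hεR (ball_subset_ball (by linarith) hx)
    simp only [hF, smul_eq_mul]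
    exact (((hw _ (hmem θ)).differentiableAt
      (isOpen_ball.mem_nhds hx')).hasDerivAt.const_mul _).const_mul _

/-- The logarithm of the norm of a holomorphic function satisfies the sub-mean value inequality. -/
theorem log_norm_le_circleAverage_of_analyticOnNhd {c : ℂ} {R : ℝ} {f : ℂ → ℂ} (hR : 0 < R)
    (hf : AnalyticOnNhd ℂ f (closedBall c R)) (hc : f c ≠ 0) :
    Real.log ‖f c‖ ≤ Real.circleAverage (fun z => Real.log ‖f z‖) c R := by
  have hR' : |R| = R := abs_of_pos hR
  rw [← hR'] at hf
  rw [AnalyticOnNhd.circleAverage_log_norm hR.ne' hf hc]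
  refine le_add_of_nonneg_left (finsum_nonneg fun u => ?_)
  have hdiv : 0 ≤ MeromorphicOn.divisor f (closedBall c |R|) u :=
    MeromorphicOn.AnalyticOnNhd.divisor_nonneg hf u
  by_cases hu : u ∈ closedBall c |R|
  · refine mul_nonneg (by exact_mod_cast hdiv) ?_
    rcases eq_or_ne c u with rfl | hne
    · simp
    · apply Real.log_nonneg
      have : 0 < ‖c - u‖ := norm_pos_iff.2 (sub_ne_zero.2 hne)
      rw [← div_eq_mul_inv, one_le_div this, ← dist_eq_norm, dist_comm]
      rwa [hR'] at hu
  · simp [hu]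

theorem posLog_norm_le_circleAverage_of_analyticOnNhd {c : ℂ} {R : ℝ} {f : ℂ → ℂ} (hR : 0 < R)
    (hf : AnalyticOnNhd ℂ f (closedBall c R)) :
    Real.posLog ‖f c‖ ≤ Real.circleAverage (fun z => Real.posLog ‖f z‖) c R := by
  rcases eq_or_ne (f c) 0 with h0 | h0
  · rw [h0, norm_zero, Real.posLog_zero]
    exact Real.circleAverage_nonneg_of_nonneg fun _ _ => Real.posLog_nonneg
  rw [Real.posLog, max_le_iff]
  refine ⟨Real.circleAverage_nonneg_of_nonneg fun _ _ => Real.posLog_nonneg,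
    (log_norm_le_circleAverage_of_analyticOnNhd hR hf h0).trans
      (Real.circleAverage_mono ?_ ?_ fun z _ => le_max_right _ _)⟩
  · refine MeromorphicOn.circleIntegrable_log_norm fun z hz => ?_
    rw [abs_of_pos hR] at hz
    exact (hf z (sphere_subset_closedBall hz)).meromorphicAt
  · refine ContinuousOn.circleIntegrable hR.le ?_
    exact Real.continuous_posLog.comp_continuousOn
      (hf.continuousOn.mono sphere_subset_closedBall).norm

/-- A lower bound for all circle averages of a nonnegative function gives a lower bound for the
integral over the disc. -/
theorem le_lintegral_ball_of_le_circleAverage {u : ℂ → ℝ} {w : ℂ} {s c : ℝ}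
    (hs : 0 ≤ s) (hc0 : 0 ≤ c) (hu : ContinuousOn u (ball w s)) (hu0 : ∀ z, 0 ≤ u z)
    (hc : ∀ t, 0 < t → t < s → c ≤ Real.circleAverage u w t) :
    ENNReal.ofReal (c * (Real.pi * s ^ 2)) ≤ ∫⁻ z in ball w s, ENNReal.ofReal (u z) := by
  set g : ℂ → ENNReal := (ball w s).indicator fun z => ENNReal.ofReal (u z) with hg
  have hgm : Measurable g := by
    classical
    have := ContinuousOn.measurable_piecewise (s := ball w s)
      (f := fun z => ENNReal.ofReal (u z)) (g := 0)
      (ENNReal.continuous_ofReal.comp_continuousOn hu) continuousOn_const measurableSet_ball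
    rwa [piecewise_eq_indicator] at this
  have h1 : ∫⁻ z in ball w s, ENNReal.ofReal (u z) = ∫⁻ z, g (w + z) := by
    rw [lintegral_add_left_eq_self, lintegral_indicator measurableSet_ball]
  have hpm : Measurable fun p : ℝ × ℝ => Complex.polarCoord.symm p := by
    simp only [Complex.polarCoord_symm_apply]; fun_prop
  have hinner : ∀ r ∈ Ioi (0 : ℝ), (Ioo 0 s).indicator
      (fun r => ENNReal.ofReal (2 * Real.pi * c * r)) r ≤
      ∫⁻ θ in Ioo (-Real.pi) Real.pi,
        ENNReal.ofReal r * g (w + Complex.polarCoord.symm (r, θ)) := by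
    intro r hr
    by_cases hrs : r < s
    · have hr0 : 0 < r := hr
      have hmem : ∀ θ, circleMap w r θ ∈ ball w s := fun θ => by
        rw [mem_ball, dist_eq_norm]; simp [abs_of_pos hr0, hrs]
      have hcont : Continuous fun θ => u (circleMap w r θ) :=
        hu.comp_continuous (continuous_circleMap w r) hmem
      rw [indicator_of_mem (show r ∈ Ioo 0 s from ⟨hr0, hrs⟩)]
      have e : ∀ θ, ENNReal.ofReal r * g (w + Complex.polarCoord.symm (r, θ)) =
          ENNReal.ofReal (r * u (circleMap w r θ)) := by
        intro θ
        have : w + Complex.polarCoord.symm (r, θ) = circleMap w r θ := by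
          simp [circleMap, Complex.exp_mul_I]
        rw [this, hg, indicator_of_mem (hmem θ), ENNReal.ofReal_mul hr0.le]
      simp only [e]
      rw [← ofReal_integral_eq_lintegral_ofReal]
      · apply ENNReal.ofReal_le_ofReal
        have h2 := hc r hr0 hrs
        rw [Real.circleAverage_eq_integral_add (-Real.pi)] at h2
        have h3 := intervalIntegral.integral_comp_add_right (a := 0) (b := 2 * Real.pi)
          (fun θ => u (circleMap w r θ)) (-Real.pi)
        rw [h3, zero_add, show 2 * Real.pi + -Real.pi = Real.pi by ring,
          intervalIntegral.integral_of_le (by linarith [Real.pi_pos]),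
          integral_Ioc_eq_integral_Ioo, smul_eq_mul, ← div_eq_inv_mul,
          le_div_iff₀ Real.two_pi_pos] at h2
        rw [integral_const_mul]
        nlinarith
      · exact ((continuous_const.mul hcont).integrableOn_Icc
          (a := -Real.pi) (b := Real.pi)).mono_set Ioo_subset_Icc_self
      · exact Eventually.of_forall fun θ => mul_nonneg hr0.le (hu0 _)
    · rw [indicator_of_notMem (fun h => hrs h.2)]
      exact zero_le
  rw [h1, ← Complex.lintegral_comp_polarCoord_symm, polarCoord_target,
    Measure.volume_eq_prod, ← Measure.prod_restrict, lintegral_prod _ (by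
      apply Measurable.aemeasurable; simp only [smul_eq_mul]; fun_prop)]
  calc ENNReal.ofReal (c * (Real.pi * s ^ 2)) =
      ∫⁻ r in Ioi (0 : ℝ), (Ioo 0 s).indicator
        (fun r => ENNReal.ofReal (2 * Real.pi * c * r)) r := by
        rw [lintegral_indicator measurableSet_Ioo, Measure.restrict_restrict measurableSet_Ioo,
          inter_eq_left.2 Ioo_subset_Ioi_self]
        rw [← ofReal_integral_eq_lintegral_ofReal]
        · rw [integral_const_mul, ← integral_Ioc_eq_integral_Ioo,
            ← intervalIntegral.integral_of_le hs, integral_id]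
          congr 1; ring
        · exact ((continuous_const.mul continuous_id).integrableOn_Icc
            (a := 0) (b := s)).mono_set Ioo_subset_Icc_self
        · filter_upwards [ae_restrict_mem measurableSet_Ioo] with r hr
          have := hr.1
          have := Real.pi_pos
          simp only [Pi.zero_apply]
          positivity
    _ ≤ _ := setLIntegral_mono' measurableSet_Ioi hinner

/-- A two-constants estimate in which the exceptional set is controlled by its area. -/
theorem norm_le_mul_rpow_of_volume_le {h : ℂ → ℂ} {w : ℂ} {s A B η : ℝ} {T : Set ℂ}
    (hs : 0 < s) (hB : 0 < B) (hBA : B ≤ A) (hη : 0 ≤ η)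
    (hd : DifferentiableOn ℂ h (ball w s)) (hA : ∀ x ∈ ball w s, ‖h x‖ ≤ A)
    (hT : ∀ x ∈ ball w s, x ∉ T → ‖h x‖ ≤ B)
    (hvol : volume T ≤ ENNReal.ofReal (η * (Real.pi * s ^ 2))) :
    ‖h w‖ ≤ B * (A / B) ^ η := by
  have hAB : 1 ≤ A / B := (one_le_div hB).2 hBA
  have hAB0 : 0 < A / B := by positivity
  set f : ℂ → ℂ := fun x => h x / B with hf
  have hfn : ∀ x, ‖f x‖ = ‖h x‖ / B := fun x => by simp [hf, abs_of_pos hB]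
  have hfd : DifferentiableOn ℂ f (ball w s) := hd.div_const _
  have hlog : Real.posLog ‖f w‖ ≤ η * Real.log (A / B) := by
    have h1 := le_lintegral_ball_of_le_circleAverage (u := fun z => Real.posLog ‖f z‖) (w := w)
      hs.le (c := Real.posLog ‖f w‖) Real.posLog_nonneg
      (Real.continuous_posLog.comp_continuousOn hfd.continuousOn.norm)
      (fun z => Real.posLog_nonneg) (fun t ht hts =>
        posLog_norm_le_circleAverage_of_analyticOnNhd ht
          ((hfd.analyticOnNhd isOpen_ball).mono (closedBall_subset_ball hts)))
    have h2 : ∫⁻ z in ball w s, ENNReal.ofReal (Real.posLog ‖f z‖) ≤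
        ENNReal.ofReal (Real.log (A / B)) * volume T := by
      calc ∫⁻ z in ball w s, ENNReal.ofReal (Real.posLog ‖f z‖)
          ≤ ∫⁻ z in ball w s, (toMeasurable volume T).indicator
              (fun _ => ENNReal.ofReal (Real.log (A / B))) z := by
            refine setLIntegral_mono' measurableSet_ball fun z hz => ?_
            by_cases hzT : z ∈ toMeasurable volume T
            · rw [indicator_of_mem hzT]
              apply ENNReal.ofReal_le_ofReal
              rw [Real.posLog, max_le_iff]
              refine ⟨Real.log_nonneg hAB, ?_⟩
              rcases eq_or_ne (f z) 0 with h0 | h0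
              · simpa [h0] using Real.log_nonneg hAB
              · apply Real.log_le_log (norm_pos_iff.2 h0)
                rw [hfn]; gcongr; exact hA z hz
            · have h3 := hT z hz (fun h' => hzT (subset_toMeasurable _ _ h'))
              rw [indicator_of_notMem hzT, Real.posLog_eq_zero_iff _ |>.2, ENNReal.ofReal_zero]
              rw [abs_norm, hfn, div_le_one hB]; exact h3
        _ ≤ ∫⁻ z, (toMeasurable volume T).indicator
              (fun _ => ENNReal.ofReal (Real.log (A / B))) z := setLIntegral_le_lintegral _ _
        _ = _ := by
            rw [lintegral_indicator (measurableSet_toMeasurable _ _), setLIntegral_const,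
              measure_toMeasurable]
    have h3 := (h1.trans h2).trans (mul_le_mul_right hvol _)
    rw [← ENNReal.ofReal_mul (Real.log_nonneg hAB)] at h3
    have hps : 0 < Real.pi * s ^ 2 := by positivity
    rw [ENNReal.ofReal_le_ofReal_iff (by have := Real.log_nonneg hAB; positivity)] at h3
    nlinarith
  rcases eq_or_ne (h w) 0 with h0 | h0
  · rw [h0, norm_zero]; positivity
  have hfw : 0 < ‖f w‖ := by rw [hfn]; have := norm_pos_iff.2 h0; positivity
  have h4 : ‖f w‖ ≤ (A / B) ^ η := by
    rw [← Real.log_le_log_iff hfw (by positivity), Real.log_rpow hAB0]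
    exact (le_max_right _ _).trans hlog
  rw [hfn, div_le_iff₀ hB] at h4
  linarith

/-- A holomorphic family `t ↦ h t w` that is bounded on a small disc for all `w`, and on a large
disc for all `w` outside a set of small area, is bounded on a disc of size comparable to the large
one. -/
theorem norm_le_of_bounded_outside_small_set {h : ℂ → ℂ → ℂ} {w₀ : ℂ} {δ δ₁ R R' s M η : ℝ}
    {T : Set ℂ} (hδ : 0 < δ) (hδR : δ ≤ R) (hδ₁ : δ < δ₁) (hδ₁R' : δ₁ ≤ R') (hR : R < R')
    (hs : 0 < s) (hM0 : 0 < M) (hη : 0 ≤ η) (hηR : (R / δ) ^ η ≤ 3 / 2)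
    (ht : ∀ w ∈ ball w₀ (2 * s), DifferentiableOn ℂ (fun t => h t w) (ball 0 R'))
    (hw : ∀ t ∈ ball (0 : ℂ) δ₁, DifferentiableOn ℂ (h t) (ball w₀ (2 * s)))
    (hM : ∀ t ∈ ball (0 : ℂ) δ₁, ∀ w ∈ ball w₀ (2 * s), ‖h t w‖ ≤ M)
    (hMT : ∀ w ∈ ball w₀ (2 * s), w ∉ T → ∀ t ∈ ball (0 : ℂ) R', ‖h t w‖ ≤ M)
    (hT : volume T ≤ ENNReal.ofReal (η * (Real.pi * s ^ 2)))
    {t w : ℂ} (htR : ‖t‖ ≤ R / 2) (hws : w ∈ ball w₀ s) : ‖h t w‖ ≤ 4 * M := by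
  have hR0 : 0 < R := hδ.trans_le hδR
  have hsub : ball w s ⊆ ball w₀ (2 * s) := ball_subset_ball' (by
    rw [mem_ball] at hws; linarith)
  have hcauchy : ∀ (k : ℕ) {ρ : ℝ}, 0 < ρ → ρ < R' → ∀ x ∈ ball w₀ (2 * s),
      (∀ t ∈ sphere (0 : ℂ) ρ, ‖h t x‖ ≤ M) →
      ‖iteratedDeriv k (fun t => h t x) 0‖ ≤ k.factorial * M / ρ ^ k :=
    fun k ρ hρ hρR x hx hb => Complex.norm_iteratedDeriv_le_of_forall_mem_sphere_norm_le k hρ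
      (((ht x hx).mono (closedBall_subset_ball hρR)).diffContOnCl_ball subset_rfl) hb
  have hcoef : ∀ k : ℕ, ‖iteratedDeriv k (fun t => h t w) 0‖ ≤
      k.factorial * M / R ^ k * (3 / 2) ^ k := by
    intro k
    have hk : (0 : ℝ) < k.factorial := by exact_mod_cast k.factorial_pos
    have key := norm_le_mul_rpow_of_volume_le (T := T)
      (h := fun x => iteratedDeriv k (fun t => h t x) 0) (w := w)
      (A := k.factorial * M / δ ^ k) (B := k.factorial * M / R ^ k) hs (by positivity)
      (by gcongr) hη
      ((differentiableOn_iteratedDeriv_of_separately_holomorphic (hδ.trans hδ₁)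
        (fun x hx => (ht x hx).mono (ball_subset_ball hδ₁R')) hw hM k).mono hsub)
      (fun x hx => hcauchy k hδ (hδ₁.trans_le hδ₁R') x (hsub hx) fun t ht' => hM t
        (sphere_subset_closedBall.trans (closedBall_subset_ball hδ₁) ht') x (hsub hx))
      (fun x hx hxT => hcauchy k hR0 hR x (hsub hx) fun t ht' => hMT x (hsub hx) hxT t
        (sphere_subset_closedBall.trans (closedBall_subset_ball hR) ht')) hT
    refine key.trans (mul_le_mul_of_nonneg_left ?_ (by positivity))
    have e : (k.factorial * M / δ ^ k) / (k.factorial * M / R ^ k) = (R / δ) ^ k := by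
      rw [div_pow]; field_simp
    rw [e, ← Real.rpow_natCast, ← Real.rpow_mul (by positivity), mul_comm,
      Real.rpow_mul (by positivity), Real.rpow_natCast]
    gcongr
  have hsum := Complex.hasSum_taylorSeries_on_ball (ht w (hsub (mem_ball_self hs)))
    (z := t) (by rw [mem_ball_zero_iff]; linarith)
  have hgeom : HasSum (fun k : ℕ => M * (3 / 4 : ℝ) ^ k) (M * (1 - 3 / 4)⁻¹) :=
    (hasSum_geometric_of_lt_one (by norm_num) (by norm_num)).mul_left M
  have hle := hsum.norm_le_of_bounded hgeom fun k => ?_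
  · linarith
  · have hk : (0 : ℝ) < k.factorial := by exact_mod_cast k.factorial_pos
    rw [norm_smul, norm_smul, norm_inv, norm_pow, sub_zero, Complex.norm_natCast]
    calc (k.factorial : ℝ)⁻¹ * (‖t‖ ^ k * ‖iteratedDeriv k (fun t => h t w) 0‖)
        ≤ (k.factorial : ℝ)⁻¹ * ((R / 2) ^ k * (k.factorial * M / R ^ k * (3 / 2) ^ k)) := by
          gcongr; exact hcoef k
      _ = M * (3 / 4 : ℝ) ^ k := by
          rw [show (3 / 4 : ℝ) = 1 / 2 * (3 / 2) by norm_num, mul_pow, div_pow, div_pow 1]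
          field_simp
          simp

/-- By Baire's theorem, a separately continuous function is bounded uniformly in the compact
variable on some ball. -/
theorem exists_ball_forall_norm_le {X Y G : Type*} [PseudoMetricSpace X] [BaireSpace X]
    [TopologicalSpace Y] [SeminormedAddCommGroup G] {f : X → Y → G} {U : Set X} {K : Set Y}
    (hU : IsOpen U) (hne : U.Nonempty) (hK : IsCompact K)
    (hx : ∀ y ∈ K, ContinuousOn (fun x => f x y) U) (hy : ∀ x ∈ U, ContinuousOn (f x) K) :
    ∃ x ∈ U, ∃ δ > 0, ∃ M : ℝ, ∀ x' ∈ ball x δ, ∀ y ∈ K, ‖f x' y‖ ≤ M := by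
  set C : ℕ → Set X := fun n => {x | x ∈ U → ∀ y ∈ K, ‖f x y‖ ≤ n} with hC
  have hclosed : ∀ n, IsClosed (C n) := by
    intro n
    rw [← isOpen_compl_iff]
    have e : (C n)ᶜ = ⋃ y ∈ K, U ∩ (fun x => ‖f x y‖) ⁻¹' Ioi (n : ℝ) := by
      ext x
      simp [hC]
    rw [e]
    exact isOpen_biUnion fun y hyK => (hx y hyK).norm.isOpen_inter_preimage hU isOpen_Ioi
  have hcover : ⋃ n, C n = univ := by
    refine eq_univ_of_forall fun x => mem_iUnion.2 ?_
    by_cases hxU : x ∈ U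
    · obtain ⟨M, hM⟩ := hK.exists_bound_of_continuousOn (hy x hxU)
      obtain ⟨n, hn⟩ := exists_nat_ge M
      exact ⟨n, fun _ y hyK => (hM y hyK).trans hn⟩
    · exact ⟨0, fun h => absurd h hxU⟩
  obtain ⟨x, hxU, hxi⟩ :=
    (dense_iUnion_interior_of_closed hclosed hcover).inter_open_nonempty U hU hne
  obtain ⟨n, hn⟩ := mem_iUnion.1 hxi
  obtain ⟨δ, hδ, hsub⟩ := isOpen_iff.1 (isOpen_interior.inter hU) x ⟨hn, hxU⟩
  exact ⟨x, hxU, δ, hδ, n, fun y hyx => interior_subset (hsub hyx).1 (hsub hyx).2⟩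

/-- A separately continuous function is bounded uniformly in the compact variable outside a set of
small measure. -/
theorem exists_measure_lt_norm_le {X Y G : Type*} [TopologicalSpace X] [TopologicalSpace Y]
    [MeasurableSpace Y] [OpensMeasurableSpace Y] [SeminormedAddCommGroup G] {μ : Measure Y}
    {f : X → Y → G} {K : Set X} {V : Set Y} (hK : IsCompact K) (hV : IsOpen V) (hμ : μ V ≠ ⊤)
    (hx : ∀ y ∈ V, ContinuousOn (fun x => f x y) K) (hy : ∀ x ∈ K, ContinuousOn (f x) V)
    {ε : ENNReal} (hε : 0 < ε) :
    ∃ m : ℕ, μ {y | y ∈ V ∧ ∃ x ∈ K, m < ‖f x y‖} ≤ ε := by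
  set T : ℕ → Set Y := fun m => {y | y ∈ V ∧ ∃ x ∈ K, m < ‖f x y‖} with hT
  have hopen : ∀ m, IsOpen (T m) := by
    intro m
    have e : T m = ⋃ x ∈ K, V ∩ (fun y => ‖f x y‖) ⁻¹' Ioi (m : ℝ) := by
      ext y
      simp only [hT, mem_ofPred_eq, mem_iUnion, mem_inter_iff, mem_preimage, mem_Ioi]
      grind
    rw [e]
    exact isOpen_biUnion fun x hxK => (hy x hxK).norm.isOpen_inter_preimage hV isOpen_Ioi
  have hanti : Antitone T := fun m n hmn y hy => ⟨hy.1, hy.2.imp fun x hx =>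
    ⟨hx.1, lt_of_le_of_lt (by exact_mod_cast hmn) hx.2⟩⟩
  have hempty : ⋂ m, T m = ∅ := by
    refine eq_empty_of_forall_notMem fun y hyT => ?_
    rw [mem_iInter] at hyT
    obtain ⟨M, hM⟩ := hK.exists_bound_of_continuousOn (hx y (hyT 0).1)
    obtain ⟨n, hn⟩ := exists_nat_ge M
    obtain ⟨x, hxK, hlt⟩ := (hyT n).2
    linarith [hM x hxK]
  have hlim := tendsto_measure_iInter_atTop (μ := μ)
    (fun m => (hopen m).measurableSet.nullMeasurableSet) hanti
    ⟨0, ne_top_of_le_ne_top hμ (measure_mono fun y hy => hy.1)⟩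
  rw [hempty, measure_empty] at hlim
  obtain ⟨m, hm⟩ := (hlim.eventually (ge_mem_nhds hε)).exists
  exact ⟨m, hm⟩

/-- **Hartogs' theorem** for functions on `E × ℂ`. -/
theorem differentiableAt_of_separately_holomorphic {E : Type*} [NormedAddCommGroup E]
    [NormedSpace ℂ E] [ProperSpace E] {f : E → ℂ → ℂ} {z₀ : E} {w₀ : ℂ} {r : ℝ} (hr : 0 < r)
    (hz : ∀ w ∈ ball w₀ r, DifferentiableOn ℂ (fun z => f z w) (ball z₀ r))
    (hw : ∀ z ∈ ball z₀ r, DifferentiableOn ℂ (f z) (ball w₀ r)) :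
    DifferentiableAt ℂ (fun p : E × ℂ => f p.1 p.2) (z₀, w₀) := by
  have hwr : closedBall w₀ (r / 2) ⊆ ball w₀ r := closedBall_subset_ball (by linarith)
  have hr8 : ball z₀ (r / 8) ⊆ ball z₀ r := ball_subset_ball (by linarith)
  obtain ⟨z₁, hz₁, δ', hδ', M₁, hM₁⟩ := exists_ball_forall_norm_le (f := f)
    (isOpen_ball (x := z₀) (ε := r / 8)) (nonempty_ball.2 (by positivity))
    (isCompact_closedBall w₀ (r / 2))
    (fun w hw' => ((hz w (hwr hw')).mono hr8).continuousOn)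
    (fun z hz' => ((hw z (hr8 hz')).mono hwr).continuousOn)
  have hKr : closedBall z₁ (3 / 4 * r) ⊆ ball z₀ r := fun z hz' => by
    rw [mem_ball] at hz₁ ⊢; rw [mem_closedBall] at hz'
    linarith [dist_triangle z z₁ z₀]
  have hwr' : ball w₀ (r / 2) ⊆ ball w₀ r := ball_subset_ball (by linarith)
  set δ₁ := min δ' (3 / 4 * r) with hδ₁
  have hδ₁0 : 0 < δ₁ := lt_min hδ' (by positivity)
  set δ := min (δ₁ / 2) (r / 2) with hδ
  have hδ0 : 0 < δ := lt_min (by positivity) (by positivity)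
  obtain ⟨η, hη0, hη⟩ : ∃ η : ℝ, 0 < η ∧ (r / 2 / δ) ^ η ≤ (3 / 2 : ℝ) := by
    have hcont : ContinuousAt (fun η : ℝ => (r / 2 / δ) ^ η) 0 :=
      Real.continuousAt_const_rpow (by positivity)
    have hev : ∀ᶠ η in 𝓝[>] (0 : ℝ), (r / 2 / δ) ^ η ≤ (3 / 2 : ℝ) :=
      (hcont.eventually (ge_mem_nhds (by norm_num))).filter_mono nhdsWithin_le_nhds
    obtain ⟨η, h1, h2⟩ := (hev.and self_mem_nhdsWithin).exists
    exact ⟨η, h2, h1⟩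
  obtain ⟨m, hm⟩ := exists_measure_lt_norm_le (μ := volume) (f := f)
    (isCompact_closedBall z₁ (3 / 4 * r)) (isOpen_ball (x := w₀) (ε := r / 2))
    measure_ball_lt_top.ne
    (fun w hw' => ((hz w (hwr' hw')).mono hKr).continuousOn)
    (fun z hz' => ((hw z (hKr hz')).mono hwr').continuousOn)
    (ε := ENNReal.ofReal (η * (Real.pi * (r / 4) ^ 2)))
    (ENNReal.ofReal_pos.2 (by positivity))
  set M : ℝ := max (max M₁ m) 1 with hM
  have hbound : ∀ z ∈ ball z₁ (r / 4), ∀ w ∈ ball w₀ (r / 4), ‖f z w‖ ≤ 4 * M := by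
    intro z hz' w hw'
    set v : E := ((4 / r : ℝ) : ℂ) • (z - z₁) with hv
    have hv1 : ‖v‖ ≤ 1 := by
      rw [mem_ball, dist_eq_norm] at hz'
      rw [hv, norm_smul, Complex.norm_real, Real.norm_of_nonneg (by positivity),
        div_mul_eq_mul_div, div_le_one hr]
      linarith
    have hmap : ∀ t : ℂ, ‖z₁ + t • v - z₁‖ ≤ ‖t‖ := fun t => by
      rw [add_sub_cancel_left, norm_smul]
      exact mul_le_of_le_one_right (norm_nonneg _) hv1
    have hball : ∀ {ρ : ℝ} {t : ℂ}, t ∈ ball 0 ρ → z₁ + t • v ∈ ball z₁ ρ := fun ht => by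
      rw [mem_ball, dist_eq_norm]
      exact (hmap _).trans_lt (mem_ball_zero_iff.1 ht)
    have h2s : ball w₀ (2 * (r / 4)) = ball w₀ (r / 2) := by congr 1; ring
    have key := norm_le_of_bounded_outside_small_set (h := fun t w => f (z₁ + t • v) w)
      (w₀ := w₀) (δ := δ) (δ₁ := δ₁) (R := r / 2) (R' := 3 / 4 * r) (s := r / 4) (M := M)
      (η := η) hδ0 (min_le_right _ _) ((min_le_left _ _).trans_lt (by linarith))
      (min_le_right _ _) (by linarith) (by positivity)
      (lt_of_lt_of_le one_pos (le_max_right _ _)) hη0.le hη ?_ ?_ ?_ ?_ hm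
      (t := ((r / 4 : ℝ) : ℂ)) ?_ hw'
    · have e : z₁ + ((r / 4 : ℝ) : ℂ) • v = z := by
        rw [hv, smul_smul, ← Complex.ofReal_mul,
          show r / 4 * (4 / r) = 1 by field_simp]
        simp
      rwa [e] at key
    · intro x hx
      rw [h2s] at hx
      exact (hz x (hwr' hx)).comp (by fun_prop) fun t ht =>
        hKr (ball_subset_closedBall (hball ht))
    · intro t ht
      rw [h2s]
      exact (hw _ (hKr (closedBall_subset_closedBall (min_le_right _ _)
        (ball_subset_closedBall (hball ht))))).mono hwr'
    · intro t ht x hx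
      rw [h2s] at hx
      exact (hM₁ _ (ball_subset_ball (min_le_left _ _) (hball ht)) x
        (ball_subset_closedBall hx)).trans ((le_max_left _ _).trans (le_max_left _ _))
    · intro x hx hxT t ht
      rw [h2s] at hx
      refine le_trans ?_ ((le_max_right M₁ m).trans (le_max_left _ 1))
      by_contra! hlt
      exact hxT ⟨hx, _, ball_subset_closedBall (hball ht), hlt⟩
    · rw [Complex.norm_real, Real.norm_of_nonneg (by positivity)]
      linarith
  have hsub : ball z₀ (r / 8) ⊆ ball z₁ (r / 4) := ball_subset_ball' (by
    rw [mem_ball, dist_comm] at hz₁; linarith)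
  have hsub' : ball w₀ (r / 8) ⊆ ball w₀ (r / 4) := ball_subset_ball (by linarith)
  have hwr8 : ball w₀ (r / 8) ⊆ ball w₀ r := ball_subset_ball (by linarith)
  exact differentiableAt_of_bounded_separately_holomorphic (r := r / 8) (M := 4 * M)
    (by positivity) (fun w hw' => (hz w (hwr8 hw')).mono hr8)
    (fun z hz' => (hw z (hr8 hz')).mono hwr8)
    fun z hzb w hwb => hbound z (hsub hzb) w (hsub' hwb)

/-- **Hartogs' theorem**: a function of finitely many complex variables, grouped into blocks, that
is holomorphic in each single variable on an open set is holomorphic there. -/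
theorem differentiableOn_of_forall_coordinate {J : Type*} [Fintype J] [DecidableEq J]
    {I : J → Type*} [∀ j, Fintype (I j)] [∀ j, DecidableEq (I j)]
    {f : (∀ j, I j → ℂ) → ℂ} {Ω : Set (∀ j, I j → ℂ)} (hΩ : IsOpen Ω)
    (hf : ∀ z ∈ Ω, ∀ j i, DifferentiableAt ℂ
      (fun t : ℂ => f (Function.update z j (Function.update (z j) i t))) (z j i)) :
    DifferentiableOn ℂ f Ω := by
  classical
  set mix : Finset (Σ j, I j) → (∀ j, I j → ℂ) → (∀ j, I j → ℂ) → ∀ j, I j → ℂ :=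
    fun S x z j i => if ⟨j, i⟩ ∈ S then x j i else z j i with hmix
  suffices H : ∀ (S : Finset (Σ j, I j)) (z x : ∀ j, I j → ℂ), mix S x z ∈ Ω →
      DifferentiableAt ℂ (fun x' => f (mix S x' z)) x by
    intro x hx
    have h1 := H Finset.univ x x (by simpa [hmix] using hx)
    simpa [hmix] using h1.differentiableWithinAt
  intro S
  induction S using Finset.induction_on with
  | empty => intro z x _; simp [hmix]
  | insert a S ha ih =>
    intro z x hx
    obtain ⟨j, i⟩ := a
    set upd : (∀ j, I j → ℂ) → ℂ → ∀ j, I j → ℂ :=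
      fun y t => Function.update y j (Function.update (y j) i t) with hupd
    have hupd_eq : ∀ y t j' i', upd y t j' i' =
        if (⟨j', i'⟩ : Σ j, I j) = ⟨j, i⟩ then t else y j' i' := by
      intro y t j' i'
      by_cases hj : j' = j
      · subst hj
        by_cases hi : i' = i
        · subst hi; simp [hupd]
        · simp [hupd, hi]
      · simp [hupd, hj]
    have hcomm : ∀ x' t, mix S x' (upd z t) = upd (mix S x' z) t := by
      intro x' t
      funext j' i'
      simp only [hmix, hupd_eq]
      grind
    have hinsert : ∀ x', mix (insert ⟨j, i⟩ S) x' z = mix S x' (upd z (x' j i)) := by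
      intro x'
      funext j' i'
      simp only [hmix, hupd_eq, Finset.mem_insert]
      by_cases h : (⟨j', i'⟩ : Σ j, I j) = ⟨j, i⟩
      · cases h; simp [ha]
      · simp [h]
    have hcont : Continuous fun p : (∀ j, I j → ℂ) × ℂ => mix S p.1 (upd z p.2) := by
      refine continuous_pi fun j' => continuous_pi fun i' => ?_
      simp only [hmix, hupd_eq]
      split_ifs <;> fun_prop
    rw [hinsert] at hx
    obtain ⟨r, hr, hsub⟩ : ∃ r > 0, ball x r ×ˢ ball (x j i) r ⊆
        (fun p : (∀ j, I j → ℂ) × ℂ => mix S p.1 (upd z p.2)) ⁻¹' Ω := by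
      simp only [ball_prod_same]
      exact Metric.isOpen_iff.1 (hΩ.preimage hcont) (x, x j i) hx
    have hmem : ∀ x' ∈ ball x r, ∀ t ∈ ball (x j i) r, mix S x' (upd z t) ∈ Ω :=
      fun x' hx' t ht => hsub (mk_mem_prod hx' ht)
    have key := differentiableAt_of_separately_holomorphic
      (f := fun x' t => f (mix S x' (upd z t))) (z₀ := x) (w₀ := x j i) hr
      (fun t ht x' hx' => (ih _ _ (hmem x' hx' t ht)).differentiableWithinAt)
      (fun x' hx' t ht => by
        have h1 := hf _ (hmem x' hx' t ht) j i
        refine DifferentiableAt.differentiableWithinAt ?_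
        have e : mix S x' (upd z t) j i = t := by rw [hcomm, hupd_eq, if_pos rfl]
        rw [e] at h1
        convert h1 using 3 with s
        rw [hcomm, hcomm]
        simp [hupd])
    have hproj : DifferentiableAt ℂ (fun x' : ∀ j, I j → ℂ => (x', x' j i)) x := by fun_prop
    simp only [hinsert]
    exact DifferentiableAt.comp (f := fun x' : ∀ j, I j → ℂ => (x', x' j i)) x key hproj

end

/-- Cross theorem for `(N,k)`-crosses in the case `A_j = D_j`: if `f` is holomorphic in
every group of `k` of the `N` variable blocks (the other blocks being fixed at an arbitrary
point of the product `D_1 × ⋯ × D_N`), then `f` is holomorphic on `D_1 × ⋯ × D_N`.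
For `k = 1` this is Hartogs' theorem on separate holomorphy. -/
theorem cross_theorem_full_case (N : ℕ) (hN : 2 ≤ N) (k : ℕ) (hk1 : 1 ≤ k) (hkN : k ≤ N)
    (n : Fin N → ℕ) (D : ∀ j, Set (Fin (n j) → ℂ))
    (hDne : ∀ j, (D j).Nonempty) (hDo : ∀ j, IsOpen (D j)) (hDc : ∀ j, IsConnected (D j))
    (f : (∀ j, Fin (n j) → ℂ) → ℂ)
    (hf : ∀ a ∈ Set.univ.pi D, ∀ S : Finset (Fin N), S.card = k →
      DifferentiableOn ℂ
        (fun z : ∀ j, Fin (n j) → ℂ => f (fun j => if j ∈ S then z j else a j))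
        {z : ∀ j, Fin (n j) → ℂ | ∀ j ∈ S, z j ∈ D j}) :
    DifferentiableOn ℂ f (Set.univ.pi D) := by
  refine differentiableOn_of_forall_coordinate
    (isOpen_set_pi Set.finite_univ fun j _ => hDo j) fun a ha j i => ?_
  obtain ⟨S, hjS, -, hS⟩ := Finset.exists_subsuperset_card_eq (Finset.subset_univ {j})
    (by simpa using hk1) (by simpa using hkN)
  rw [Finset.singleton_subset_iff] at hjS
  have hopen : IsOpen {z : ∀ j, Fin (n j) → ℂ | ∀ j ∈ S, z j ∈ D j} :=
    isOpen_set_pi S.finite_toSet fun j _ => hDo j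
  have h1 := (hf a ha S hS).differentiableAt
    (hopen.mem_nhds (x := a) fun j _ => ha j (Set.mem_univ j))
  have hcurve : DifferentiableAt ℂ
      (fun t : ℂ => Function.update a j (Function.update (a j) i t)) (a j i) := by
    refine differentiableAt_pi.2 fun j' => differentiableAt_pi.2 fun i' => ?_
    by_cases hj : j' = j
    · subst hj
      by_cases hi : i' = i
      · subst hi; simp
      · simp [hi]
    · simp [hj]
  have h2 := DifferentiableAt.comp (a j i) (f := fun t : ℂ =>
    Function.update a j (Function.update (a j) i t)) (by simpa using h1) hcurve
  refine h2.congr_of_eventuallyEq (Filter.Eventually.of_forall fun t => ?_)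
  simp only [Function.comp_apply]
  congr 1
  funext j'
  by_cases hj : j' = j
  · subst hj; simp [hjS]
  · simp [hj]
end

section
/- Let N ≥ 2 and for j = 1,…,N let A_j ⊆ ℂ^{n_j} be a nonempty open set. Let X = ⋃_{j=1}^N A_1 × ⋯ × A_{j-1} × ℂ^{n_j} × A_{j+1} × ⋯ × A_N be the N-fold cross with D_j = ℂ^{n_j}, and let f : X → ℂ be separately holomorphic on X. Then there exists exactly one entire function F : ℂ^{n_1 + ⋯ + n_N} → ℂ such that F = f on X, and moreover sup_{ℂ^{n_1+⋯+n_N}} |F| = sup_X |f|. -/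
section

open Metric Set Filter MeasureTheory Topology

section

variable {E : Type*} [NormedAddCommGroup E] [NormedSpace ℂ E]

theorem norm_fderiv_le_of_norm_le_on_ball {f : E → ℂ} {x : E} {r C : ℝ} (hr : 0 < r)
    (hf : DifferentiableOn ℂ f (ball x r)) (hC : ∀ y ∈ ball x r, ‖f y‖ ≤ C) :
    ‖fderiv ℂ f x‖ ≤ 2 * C / r := by
  refine Complex.norm_fderiv_le_div_of_mapsTo_ball hf (fun y hy => ?_) hr
  rw [mem_closedBall, dist_eq_norm, two_mul]
  exact (norm_sub_le _ _).trans (add_le_add (hC y hy) (hC x (mem_ball_self hr)))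

/-- A uniform limit of holomorphic functions on an open subset of a complex normed space is
holomorphic. -/
theorem differentiableOn_of_tendstoUniformlyOn {U : Set E} (hU : IsOpen U) {f : ℕ → E → ℂ}
    {g : E → ℂ} (hf : ∀ n, DifferentiableOn ℂ (f n) U) (hfg : TendstoUniformlyOn f g atTop U) :
    DifferentiableOn ℂ g U := by
  intro x hx
  obtain ⟨ε, hε, hεU⟩ := Metric.isOpen_iff.1 hU x hx
  have hsub : ∀ y ∈ ball x (ε / 2), ball y (ε / 2) ⊆ U := fun y hy =>
    (ball_subset_ball' (by rw [mem_ball] at hy; linarith)).trans hεU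
  have hmem : ∀ y ∈ ball x (ε / 2), y ∈ U := fun y hy => hsub y hy (mem_ball_self (by positivity))
  have hd : ∀ n, ∀ y ∈ U, HasFDerivAt (f n) (fderiv ℂ (f n) y) y := fun n y hy =>
    ((hf n).differentiableAt (hU.mem_nhds hy)).hasFDerivAt
  have hcauchy : UniformCauchySeqOn (fun n => fderiv ℂ (f n)) atTop (ball x (ε / 2)) := by
    rw [Metric.uniformCauchySeqOn_iff]
    intro η hη
    obtain ⟨N, hN⟩ := Metric.uniformCauchySeqOn_iff.1 hfg.uniformCauchySeqOn (η * ε / 8)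
      (by positivity)
    refine ⟨N, fun m hm n hn y hy => ?_⟩
    have hyU := hmem y hy
    rw [dist_eq_norm, ← ((hd m y hyU).sub (hd n y hyU)).fderiv]
    refine (norm_fderiv_le_of_norm_le_on_ball (C := η * ε / 8) (half_pos hε)
      (((hf m).sub (hf n)).mono (hsub y hy)) fun v hv => ?_).trans_lt ?_
    · have := hN m hm n hn v (hsub y hy hv)
      rw [dist_eq_norm] at this
      exact this.le
    · rw [show 2 * (η * ε / 8) / (ε / 2) = η / 2 by field_simp; norm_num]
      linarith
  have hlim : ∀ y ∈ ball x (ε / 2), ∃ L, Tendsto (fun n => fderiv ℂ (f n) y) atTop (𝓝 L) :=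
    fun y hy => cauchySeq_tendsto_of_complete (hcauchy.cauchySeq hy)
  choose! g' hg' using hlim
  exact (hasFDerivAt_of_tendstoUniformlyOn isOpen_ball
    (hcauchy.tendstoUniformlyOn_of_tendsto hg') (fun n y hy => hd n y (hmem y hy))
    (fun y hy => hfg.tendsto_at (hmem y hy))
    (mem_ball_self (half_pos hε))).differentiableAt.differentiableWithinAt

/-- The Weierstrass M-test for holomorphic functions on a complex normed space. -/
theorem differentiableOn_tsum_of_norm_le {U : Set E} (hU : IsOpen U) {f : ℕ → E → ℂ} {u : ℕ → ℝ}
    (hu : Summable u) (hf : ∀ n, DifferentiableOn ℂ (f n) U) (hfu : ∀ n, ∀ x ∈ U, ‖f n x‖ ≤ u n) :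
    DifferentiableOn ℂ (fun x => ∑' n, f n x) U :=
  differentiableOn_of_tendstoUniformlyOn hU
    (fun _ => DifferentiableOn.fun_sum fun n _ => hf n) (tendstoUniformlyOn_tsum_nat hu hfu)

theorem norm_deriv_le_of_norm_le_on_ball {f : ℂ → ℂ} {t : ℂ} {s M : ℝ} (hs : 0 < s)
    (hf : DifferentiableOn ℂ f (ball t s)) (hM : ∀ y ∈ ball t s, ‖f y‖ ≤ M) :
    ‖deriv f t‖ ≤ 2 * M / s := by
  rw [norm_deriv_eq_norm_fderiv]
  exact norm_fderiv_le_of_norm_le_on_ball hs hf hM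

theorem norm_slope_sub_deriv_le {f : ℂ → ℂ} {t y : ℂ} {s M : ℝ} (hs : 0 < s)
    (hf : DifferentiableOn ℂ f (ball t s)) (hM : ∀ y ∈ ball t s, ‖f y‖ ≤ M)
    (hy : y ∈ ball t s) (hyt : y ≠ t) :
    ‖slope f t y - deriv f t‖ ≤ 4 * M / s / s * ‖y - t‖ := by
  have hmaps : MapsTo f (ball t s) (closedBall (f t) (2 * M)) := fun v hv => by
    rw [mem_closedBall, dist_eq_norm, two_mul]
    exact (norm_sub_le _ _).trans (add_le_add (hM v hv) (hM t (mem_ball_self hs)))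
  have hds : DifferentiableOn ℂ (dslope f t) (ball t s) :=
    (Complex.differentiableOn_dslope (ball_mem_nhds t hs)).2 hf
  have hbd : ∀ v ∈ ball t s, ‖dslope f t v‖ ≤ 2 * M / s := fun v hv =>
    Complex.norm_dslope_le_div_of_mapsTo_ball hf hmaps hv
  have hmaps' : MapsTo (dslope f t) (ball t s) (closedBall (dslope f t t) (4 * M / s)) :=
    fun v hv => by
      rw [mem_closedBall, dist_eq_norm, show 4 * M / s = 2 * M / s + 2 * M / s by ring]
      exact (norm_sub_le _ _).trans (add_le_add (hbd v hv) (hbd t (mem_ball_self hs)))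
  have := Complex.dist_le_div_mul_dist_of_mapsTo_ball hds hmaps' hy
  rwa [dslope_same, dslope_of_ne _ hyt, dist_eq_norm, dist_eq_norm] at this

/-- The derivative in `t` of a separately holomorphic locally bounded function is holomorphic in the
parameter. -/
theorem differentiableOn_deriv_of_bounded {U : Set E} (hU : IsOpen U) {G : E → ℂ → ℂ} {t : ℂ}
    {s M : ℝ} (hs : 0 < s) (hG : ∀ p ∈ U, DifferentiableOn ℂ (G p) (ball t s))
    (hGt : ∀ y ∈ ball t s, DifferentiableOn ℂ (fun p => G p y) U)
    (hM : ∀ p ∈ U, ∀ y ∈ ball t s, ‖G p y‖ ≤ M) :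
    DifferentiableOn ℂ (fun p => deriv (G p) t) U := by
  set h : ℕ → ℂ := fun n => ((s / (n + 2) : ℝ) : ℂ) with hh
  have hn (n : ℕ) : ‖h n‖ = s / (n + 2) := by
    rw [hh, Complex.norm_real, Real.norm_of_nonneg (by positivity)]
  have hmem (n : ℕ) : t + h n ∈ ball t s := by
    rw [mem_ball, dist_eq_norm, add_sub_cancel_left, hn]
    exact div_lt_self hs (by linarith [n.cast_nonneg (α := ℝ)])
  have hne (n : ℕ) : t + h n ≠ t := by
    have : 0 < ‖h n‖ := by rw [hn]; positivity
    simpa using norm_pos_iff.1 this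
  refine differentiableOn_of_tendstoUniformlyOn hU (f := fun n p => slope (G p) t (t + h n))
    (fun n => ?_) ?_
  · simp only [slope_def_field, div_eq_mul_inv]
    exact ((hGt _ (hmem n)).sub (hGt _ (mem_ball_self hs))).mul_const _
  · have hlim : Tendsto (fun n : ℕ => 4 * M / s / s * (s / ((n : ℝ) + 2))) atTop (𝓝 0) := by
      have : Tendsto (fun n : ℕ => s / ((n : ℝ) + 2)) atTop (𝓝 0) :=
        tendsto_const_nhds.div_atTop
          (tendsto_atTop_add_const_right _ _ tendsto_natCast_atTop_atTop)
      simpa using this.const_mul (4 * M / s / s)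
    rw [Metric.tendstoUniformlyOn_iff]
    intro ε hε
    filter_upwards [hlim.eventually (gt_mem_nhds hε)] with n hn' p hp
    rw [dist_comm, dist_eq_norm]
    refine lt_of_le_of_lt ?_ hn'
    simpa [hn] using norm_slope_sub_deriv_le hs (hG p hp) (hM p hp) (hmem n) (hne n)

/-- Taylor coefficients of a separately holomorphic locally bounded function are holomorphic in the
parameter. -/
theorem differentiableOn_iteratedDeriv_of_bounded {U : Set E} (hU : IsOpen U) {a : ℂ} {ρ : ℝ}
    (hρ : 0 < ρ) (k : ℕ) {G : E → ℂ → ℂ} (hG : ∀ p ∈ U, DifferentiableOn ℂ (G p) (ball a ρ))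
    (hGt : ∀ y ∈ ball a ρ, DifferentiableOn ℂ (fun p => G p y) U)
    (hM : ∀ r < ρ, ∃ M, ∀ p ∈ U, ∀ y ∈ ball a r, ‖G p y‖ ≤ M) :
    DifferentiableOn ℂ (fun p => iteratedDeriv k (G p) a) U := by
  induction k generalizing G with
  | zero => simpa using hGt a (mem_ball_self hρ)
  | succ k ih =>
    simp only [iteratedDeriv_succ']
    refine ih (fun p hp => (hG p hp).deriv isOpen_ball) (fun t ht => ?_) fun r hr => ?_
    · obtain ⟨r, hr, hrρ⟩ := exists_between (mem_ball.1 ht)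
      obtain ⟨M, hM⟩ := hM r hrρ
      have hsub : ball t (r - dist t a) ⊆ ball a r := ball_subset_ball' (by linarith)
      have hsub' : ball a r ⊆ ball a ρ := ball_subset_ball hrρ.le
      exact differentiableOn_deriv_of_bounded hU (sub_pos.2 hr)
        (fun p hp => (hG p hp).mono (hsub.trans hsub')) (fun y hy => hGt y (hsub' (hsub hy)))
        fun p hp y hy => hM p hp y (hsub hy)
    · obtain ⟨r', hr', hrρ⟩ := exists_between hr
      obtain ⟨M, hM⟩ := hM r' hrρ
      refine ⟨2 * M / (r' - r), fun p hp t ht => ?_⟩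
      have hsub : ball t (r' - r) ⊆ ball a r' :=
        ball_subset_ball' (by rw [mem_ball] at ht; linarith)
      exact norm_deriv_le_of_norm_le_on_ball (sub_pos.2 hr')
        ((hG p hp).mono (hsub.trans (ball_subset_ball hrρ.le))) fun y hy => hM p hp y (hsub hy)

/-- A power series with holomorphic coefficients and uniform Cauchy bounds is jointly holomorphic. -/
theorem differentiableOn_tsum_pow_mul {U : Set E} (hU : IsOpen U) {a : ℂ} {R M : ℝ}
    {c : ℕ → E → ℂ} (hc : ∀ k, DifferentiableOn ℂ (c k) U)
    (hM : ∀ k, ∀ p ∈ U, ‖c k p‖ * R ^ k ≤ M) :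
    DifferentiableOn ℂ (fun q : E × ℂ => ∑' k, c k q.1 * (q.2 - a) ^ k) (U ×ˢ ball a R) := by
  rintro ⟨p, t⟩ ⟨hp, ht⟩
  obtain ⟨r, hr, hrR⟩ := exists_between (mem_ball.1 ht)
  have hr0 : 0 < r := dist_nonneg.trans_lt hr
  have hR0 : 0 < R := hr0.trans hrR
  have hopen : IsOpen (U ×ˢ ball a r) := hU.prod isOpen_ball
  have hsum : Summable fun k => M * (r / R) ^ k :=
    (summable_geometric_of_lt_one (by positivity) ((div_lt_one hR0).2 hrR)).mul_left M
  refine ((differentiableOn_tsum_of_norm_le hopen hsum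
    (f := fun k (q : E × ℂ) => c k q.1 * (q.2 - a) ^ k) (fun k => ?_) ?_).differentiableAt
      (hopen.mem_nhds ⟨hp, hr⟩)).differentiableWithinAt
  · exact ((hc k).comp differentiableOn_fst fun q hq => hq.1).mul (by fun_prop)
  · rintro k ⟨p, t⟩ ⟨hp, ht⟩
    rw [norm_mul, norm_pow, div_pow, mul_div_assoc', le_div_iff₀ (by positivity)]
    have h1 : ‖t - a‖ ^ k ≤ r ^ k :=
      pow_le_pow_left₀ (norm_nonneg _) (by simpa [dist_eq_norm] using (mem_ball.1 ht).le) k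
    calc _ = (‖c k p‖ * R ^ k) * ‖t - a‖ ^ k := by ring
      _ ≤ _ := mul_le_mul (hM k p hp) h1 (by positivity)
        (le_trans (by positivity) (hM k p hp))

end

theorem log_norm_le_circleAverage_log_norm {g : ℂ → ℂ} {z : ℂ} {r : ℝ} (hr : 0 < r)
    (hg : AnalyticOnNhd ℂ g (closedBall z |r|)) (hgz : g z ≠ 0) :
    Real.log ‖g z‖ ≤ Real.circleAverage (fun x => Real.log ‖g x‖) z r := by
  rw [hg.circleAverage_log_norm hr.ne' hgz]
  refine le_add_of_nonneg_left (finsum_nonneg fun u => ?_)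
  by_cases hu : u ∈ closedBall z |r|
  · refine mul_nonneg (by exact_mod_cast MeromorphicOn.AnalyticOnNhd.divisor_nonneg hg u) ?_
    by_cases huz : u = z
    · simp [huz]
    · apply Real.log_nonneg
      have : 0 < ‖z - u‖ := norm_pos_iff.2 (sub_ne_zero.2 (Ne.symm huz))
      rw [← div_eq_mul_inv, le_div_iff₀ this, one_mul]
      rw [mem_closedBall, dist_comm, dist_eq_norm, abs_of_pos hr] at hu
      exact hu
  · simp [hu]

/-- The arcs of a circle on which a bounded holomorphic function is small cannot be too long. -/
theorem mul_lintegral_indicator_circleMap_le {g : ℂ → ℂ} {z : ℂ} {r L : ℝ} {S : Set ℂ} (hr : 0 < r)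
    (hg : AnalyticOnNhd ℂ g (closedBall z |r|)) (h1 : ∀ x ∈ closedBall z |r|, ‖g x‖ ≤ 1)
    (hSg : ∀ x ∈ S, ‖g x‖ ≤ Real.exp (-L)) (hS0 : ∀ x ∈ S, g x ≠ 0) (hgz : g z ≠ 0) :
    ENNReal.ofReal L * ∫⁻ θ in Ioo (-Real.pi) Real.pi, S.indicator 1 (circleMap z r θ) ≤
      ENNReal.ofReal (2 * Real.pi * -Real.log ‖g z‖) := by
  have hJ := log_norm_le_circleAverage_log_norm hr hg hgz
  have hint : CircleIntegrable (fun x => Real.log ‖g x‖) z r :=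
    MeromorphicOn.circleIntegrable_log_norm fun x hx =>
      (hg x (sphere_subset_closedBall hx)).meromorphicAt
  set F : ℝ → ℝ := fun θ => -Real.log ‖g (circleMap z r θ)‖ with hF
  have hper : Function.Periodic F (2 * Real.pi) := fun θ => by
    simp only [hF, periodic_circleMap z r θ]
  have hFint : IntervalIntegrable F volume 0 (2 * Real.pi) := IntervalIntegrable.neg hint
  have hFint' : IntervalIntegrable F volume (-Real.pi) Real.pi := by
    exact hper.intervalIntegrable (by positivity) (t := 0) (by simpa using hFint) _ _
  have heq : ∫ θ in (-Real.pi)..Real.pi, F θ = ∫ θ in (0 : ℝ)..2 * Real.pi, F θ := by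
    have := hper.intervalIntegral_add_eq (-Real.pi) 0
    rw [show -Real.pi + 2 * Real.pi = Real.pi by ring, zero_add] at this
    exact this
  have hmem (θ : ℝ) : circleMap z r θ ∈ closedBall z |r| :=
    sphere_subset_closedBall (circleMap_mem_sphere' z r θ)
  have hF0 (θ : ℝ) : 0 ≤ F θ :=
    neg_nonneg.2 (Real.log_nonpos (norm_nonneg _) (h1 _ (hmem θ)))
  have hle : ∫ θ in (-Real.pi)..Real.pi, F θ ≤ 2 * Real.pi * -Real.log ‖g z‖ := by
    rw [heq]
    simp only [hF, intervalIntegral.integral_neg]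
    rw [Real.circleAverage_def, smul_eq_mul, inv_mul_eq_div,
      le_div_iff₀ (by positivity)] at hJ
    linarith
  have hpi : -Real.pi ≤ Real.pi := by linarith [Real.pi_pos]
  refine le_trans ?_ (ENNReal.ofReal_le_ofReal hle)
  rw [intervalIntegral.integral_of_le hpi, integral_Ioc_eq_integral_Ioo,
    ofReal_integral_eq_lintegral_ofReal
      (((intervalIntegrable_iff_integrableOn_Ioo_of_le hpi).1 hFint')) (ae_of_all _ hF0),
    ← lintegral_const_mul']
  · refine lintegral_mono fun θ => ?_
    by_cases hθ : circleMap z r θ ∈ S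
    · simp only [hθ, indicator_of_mem, Pi.one_apply, mul_one]
      refine ENNReal.ofReal_le_ofReal (le_neg_of_le_neg ?_)
      exact (Real.log_le_iff_le_exp (norm_pos_iff.2 (hS0 _ hθ))).2 (hSg _ hθ)
    · simp [hθ]
  · exact ENNReal.ofReal_ne_top

/-- The set on which a bounded holomorphic function is small cannot be too large. -/
theorem volume_mul_le_of_ne_zero {g : ℂ → ℂ} {z : ℂ} {ρ L : ℝ} {S : Set ℂ}
    (hS : MeasurableSet S) (hSz : S ⊆ ball z ρ) (hg : DifferentiableOn ℂ g (ball z ρ))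
    (h1 : ∀ x ∈ ball z ρ, ‖g x‖ ≤ 1) (hρ : 0 < ρ)
    (hSg : ∀ x ∈ S, ‖g x‖ ≤ Real.exp (-L)) (hS0 : ∀ x ∈ S, g x ≠ 0) (hgz : g z ≠ 0) :
    ENNReal.ofReal L * volume S ≤ ENNReal.ofReal (2 * Real.pi * ρ ^ 2 * -Real.log ‖g z‖) := by
  have hmeas : Measurable fun p : ℝ × ℝ => S.indicator (1 : ℂ → ENNReal) (circleMap z p.1 p.2) :=
    (measurable_one.indicator hS).comp
      (show Continuous fun x : ℝ × ℝ => circleMap z x.1 x.2 by fun_prop [circleMap]).measurable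
  have hvol : volume S = ∫⁻ r in Ioi (0 : ℝ), ENNReal.ofReal r *
      ∫⁻ θ in Ioo (-Real.pi) Real.pi, S.indicator 1 (circleMap z r θ) := by
    have h0 : volume S = ∫⁻ p : ℂ, S.indicator 1 (z + p) := by
      rw [lintegral_add_left_eq_self (fun p => S.indicator (1 : ℂ → ENNReal) p) z,
        lintegral_indicator_one hS]
    rw [h0, ← Complex.lintegral_comp_polarCoord_symm]
    rw [show polarCoord.target = Ioi (0 : ℝ) ×ˢ Ioo (-Real.pi) Real.pi from rfl,
      Measure.volume_eq_prod, ← Measure.prod_restrict]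
    have hcm (p : ℝ × ℝ) : z + Complex.polarCoord.symm p = circleMap z p.1 p.2 := by
      rw [Complex.polarCoord_symm_apply, circleMap, Complex.exp_mul_I]
      push_cast
      ring
    simp only [hcm, smul_eq_mul]
    rw [lintegral_prod _ (Measurable.aemeasurable (by fun_prop))]
    refine lintegral_congr fun r => ?_
    rw [lintegral_const_mul' _ _ ENNReal.ofReal_ne_top]
  have hlog : 0 ≤ -Real.log ‖g z‖ :=
    neg_nonneg.2 (Real.log_nonpos (norm_nonneg _) (h1 _ (mem_ball_self hρ)))
  rw [hvol, ← lintegral_const_mul' _ _ ENNReal.ofReal_ne_top]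
  have hbd : ∀ r ∈ Ioi (0 : ℝ), ENNReal.ofReal L * (ENNReal.ofReal r *
      ∫⁻ θ in Ioo (-Real.pi) Real.pi, S.indicator 1 (circleMap z r θ)) ≤
      (Ioo 0 ρ).indicator
        (fun _ => ENNReal.ofReal ρ * ENNReal.ofReal (2 * Real.pi * -Real.log ‖g z‖)) r := by
    intro r hr
    by_cases hrρ : r < ρ
    · rw [indicator_of_mem (show r ∈ Ioo 0 ρ from ⟨hr, hrρ⟩), mul_left_comm]
      have hsub : closedBall z |r| ⊆ ball z ρ :=
        closedBall_subset_ball (by rwa [abs_of_pos hr])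
      exact mul_le_mul' (ENNReal.ofReal_le_ofReal hrρ.le)
        (mul_lintegral_indicator_circleMap_le hr
          ((hg.analyticOnNhd isOpen_ball).mono hsub) (fun x hx => h1 x (hsub hx)) hSg hS0 hgz)
    · have : ∀ θ, S.indicator (1 : ℂ → ENNReal) (circleMap z r θ) = 0 := fun θ => by
        refine indicator_of_notMem (fun h => hrρ ?_) _
        have := hSz h
        rwa [mem_ball, mem_sphere.1 (circleMap_mem_sphere z (le_of_lt hr) θ)] at this
      simp [this]
  calc _ ≤ ∫⁻ r in Ioi (0 : ℝ), (Ioo 0 ρ).indicator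
        (fun _ => ENNReal.ofReal ρ * ENNReal.ofReal (2 * Real.pi * -Real.log ‖g z‖)) r :=
      setLIntegral_mono' measurableSet_Ioi hbd
    _ ≤ ∫⁻ r, (Ioo 0 ρ).indicator
        (fun _ => ENNReal.ofReal ρ * ENNReal.ofReal (2 * Real.pi * -Real.log ‖g z‖)) r :=
      setLIntegral_le_lintegral _ _
    _ = _ := by
      rw [lintegral_indicator_const measurableSet_Ioo, Real.volume_Ioo, sub_zero,
        ← ENNReal.ofReal_mul hρ.le, ← ENNReal.ofReal_mul (by positivity)]
      congr 1
      ring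

/-- A two-constants inequality. -/
theorem norm_le_exp_of_small_on {g : ℂ → ℂ} {z : ℂ} {ρ L α : ℝ} {S : Set ℂ}
    (hS : MeasurableSet S) (hSz : S ⊆ ball z ρ) (hg : DifferentiableOn ℂ g (ball z ρ))
    (h1 : ∀ x ∈ ball z ρ, ‖g x‖ ≤ 1) (hρ : 0 < ρ) (hα : 0 ≤ α)
    (hSα : ENNReal.ofReal α ≤ volume S)
    (hSg : ∀ x ∈ S, ‖g x‖ ≤ Real.exp (-L)) :
    ‖g z‖ ≤ Real.exp (-(α / (2 * Real.pi * ρ ^ 2) * L)) := by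
  rcases lt_or_ge L 0 with hL | hL
  · refine (h1 z (mem_ball_self hρ)).trans (Real.one_le_exp ?_)
    have : 0 ≤ α / (2 * Real.pi * ρ ^ 2) := by positivity
    nlinarith
  by_cases hgz : g z = 0
  · rw [hgz, norm_zero]
    positivity
  have han := hg.analyticOnNhd isOpen_ball
  have hcod : g ⁻¹' {0}ᶜ ∈ codiscreteWithin (ball z ρ) :=
    han.preimage_zero_mem_codiscreteWithin hgz (mem_ball_self hρ)
      ⟨⟨z, mem_ball_self hρ⟩, (convex_ball z ρ).isPreconnected⟩
  have hae : ∀ᵐ x ∂volume.restrict (ball z ρ), g x ≠ 0 :=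
    ae_restrict_le_codiscreteWithin measurableSet_ball hcod
  set S' := S ∩ {x | x ∈ ball z ρ ∧ g x ≠ 0} with hS'
  have hopen : IsOpen {x | x ∈ ball z ρ ∧ g x ≠ 0} :=
    hg.continuousOn.isOpen_inter_preimage isOpen_ball isOpen_compl_singleton
  have hvol : volume S ≤ volume S' := by
    refine measure_mono_ae ?_
    filter_upwards [(ae_restrict_iff' measurableSet_ball).1 hae] with x hx hxS
    exact ⟨hxS, hSz hxS, hx (hSz hxS)⟩
  have := volume_mul_le_of_ne_zero (S := S') (hS.inter hopen.measurableSet)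
    (inter_subset_left.trans hSz) hg h1 hρ (fun x hx => hSg x hx.1) (fun x hx => hx.2.2) hgz
  have h2 : ENNReal.ofReal (L * α) ≤ ENNReal.ofReal (2 * Real.pi * ρ ^ 2 * -Real.log ‖g z‖) := by
    rw [ENNReal.ofReal_mul hL]
    exact (mul_le_mul' le_rfl (hSα.trans hvol)).trans this
  have hlog : 0 ≤ -Real.log ‖g z‖ :=
    neg_nonneg.2 (Real.log_nonpos (norm_nonneg _) (h1 _ (mem_ball_self hρ)))
  rw [ENNReal.ofReal_le_ofReal_iff (by positivity)] at h2
  rw [← Real.log_le_iff_le_exp (norm_pos_iff.2 hgz), le_neg, div_mul_eq_mul_div,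
    div_le_iff₀ (by positivity)]
  linarith

section

/-- The Taylor coefficients of a function of one complex variable. -/
noncomputable def taylorCoeff (f : ℂ → ℂ) (a : ℂ) (k : ℕ) : ℂ :=
  (k.factorial : ℂ)⁻¹ * iteratedDeriv k f a

theorem hasSum_taylorCoeff {f : ℂ → ℂ} {a z : ℂ} {r : ℝ} (hf : DifferentiableOn ℂ f (ball a r))
    (hz : z ∈ ball a r) : HasSum (fun k => taylorCoeff f a k * (z - a) ^ k) (f z) := by
  have h : (fun k => taylorCoeff f a k * (z - a) ^ k) =
      fun k => (k.factorial : ℂ)⁻¹ • (z - a) ^ k • iteratedDeriv k f a := by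
    funext k
    simp only [taylorCoeff, smul_eq_mul]
    ring
  rw [h]
  exact Complex.hasSum_taylorSeries_on_ball hf hz

theorem norm_taylorCoeff_mul_pow_le {f : ℂ → ℂ} {a : ℂ} {r ρ C : ℝ} (hr : 0 < r) (hrρ : r < ρ)
    (hf : DifferentiableOn ℂ f (ball a ρ)) (hC : ∀ z ∈ closedBall a r, ‖f z‖ ≤ C) (k : ℕ) :
    ‖taylorCoeff f a k‖ * r ^ k ≤ C := by
  have hd : DiffContOnCl ℂ f (ball a r) :=
    hf.diffContOnCl_ball (closedBall_subset_ball hrρ)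
  have := Complex.norm_iteratedDeriv_le_of_forall_mem_sphere_norm_le k hr hd
    fun z hz => hC z (sphere_subset_closedBall hz)
  have hk : (0 : ℝ) < k.factorial := by positivity
  rw [le_div_iff₀ (by positivity)] at this
  rw [taylorCoeff, norm_mul, norm_inv, Complex.norm_natCast, mul_assoc, inv_mul_le_iff₀ hk]
  exact this

variable {E : Type*} [NormedAddCommGroup E] [NormedSpace ℂ E]

theorem differentiableOn_taylorCoeff {U : Set E} (hU : IsOpen U) {a : ℂ} {ρ : ℝ}
    (hρ : 0 < ρ) (k : ℕ) {G : E → ℂ → ℂ} (hG : ∀ p ∈ U, DifferentiableOn ℂ (G p) (ball a ρ))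
    (hGt : ∀ y ∈ ball a ρ, DifferentiableOn ℂ (fun p => G p y) U)
    (hM : ∀ r < ρ, ∃ M, ∀ p ∈ U, ∀ y ∈ ball a r, ‖G p y‖ ≤ M) :
    DifferentiableOn ℂ (fun p => taylorCoeff (G p) a k) U :=
  (differentiableOn_iteratedDeriv_of_bounded hU hρ k hG hGt hM).const_mul _

theorem exists_ball_subset_of_subset_iUnion {X : Type*} [PseudoMetricSpace X] [CompleteSpace X]
    {D : Set X} (hD : IsOpen D) (hne : D.Nonempty) {S : ℕ → Set X}
    (hS : ∀ n, IsClosed ((↑) ⁻¹' S n : Set D)) (hcov : D ⊆ ⋃ n, S n) :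
    ∃ n b s, 0 < s ∧ b ∈ D ∧ ball b s ⊆ D ∧ ball b s ⊆ S n := by
  have := hD.baireSpace
  have : Nonempty D := hne.to_subtype
  obtain ⟨n, x, hx⟩ := nonempty_interior_of_iUnion_of_closed hS (by
    rw [← preimage_iUnion]
    exact eq_univ_of_forall fun x => hcov x.2)
  have hopen : IsOpen ((↑) '' interior ((↑) ⁻¹' S n : Set D) : Set X) :=
    hD.isOpenMap_subtype_val _ isOpen_interior
  obtain ⟨s, hs, hsub⟩ := Metric.isOpen_iff.1 hopen x ⟨x, hx, rfl⟩
  refine ⟨n, x, s, hs, x.2, fun y hy => ?_, fun y hy => ?_⟩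
  · obtain ⟨y', -, rfl⟩ := hsub hy
    exact y'.2
  · obtain ⟨y', hy', rfl⟩ := hsub hy
    exact interior_subset (s := ((↑) : D → X) ⁻¹' S n) hy'

theorem exists_nat_norm_le {X : Type*} [PseudoMetricSpace X] [ProperSpace X] {f : X → ℂ}
    (hf : Continuous f) (a : X) (R : ℝ) : ∃ n : ℕ, ∀ x ∈ closedBall a R, ‖f x‖ ≤ n := by
  obtain ⟨C, hC⟩ := (isCompact_closedBall a R).exists_bound_of_continuousOn hf.continuousOn
  obtain ⟨n, hn⟩ := exists_nat_ge C
  exact ⟨n, fun x hx => (hC x hx).trans hn⟩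

/-- A function that is holomorphic in `w` for `z` in a small disc, and entire in `z`, is jointly
holomorphic and bounded on a product of a ball with an arbitrarily large disc. -/
theorem exists_differentiableOn_ball_prod [CompleteSpace E] {D : Set E} (hD : IsOpen D)
    (hne : D.Nonempty) {g : E → ℂ → ℂ} {a : ℂ} {δ : ℝ} (hδ : 0 < δ)
    (hgz : ∀ z ∈ ball a δ, DifferentiableOn ℂ (fun w => g w z) D)
    (hgw : ∀ w ∈ D, Differentiable ℂ (g w)) {R : ℝ} (hR : 0 < R) :
    ∃ b s M, 0 < s ∧ DifferentiableOn ℂ (fun q : E × ℂ => g q.1 q.2) (ball b s ×ˢ ball a R) ∧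
      ∀ w ∈ ball b s, ∀ z ∈ ball a R, ‖g w z‖ ≤ M := by
  obtain ⟨n₁, b₁, s₁, hs₁, -, hsub₁, hn₁⟩ := exists_ball_subset_of_subset_iUnion hD hne
    (S := fun n => {w | ∀ z ∈ ball a δ, ‖g w z‖ ≤ n}) (fun n => by
      have : ((↑) ⁻¹' {w | ∀ z ∈ ball a δ, ‖g w z‖ ≤ n} : Set D) =
          ⋂ z ∈ ball a δ, {w : D | ‖g w z‖ ≤ n} := by ext; simp
      rw [this]
      exact isClosed_biInter fun z hz => isClosed_le
        ((hgz z hz).continuousOn.domRestrict.norm) continuous_const) fun w hw => by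
      obtain ⟨n, hn⟩ := exists_nat_norm_le (hgw w hw).continuous a δ
      exact mem_iUnion.2 ⟨n, fun z hz => hn z (ball_subset_closedBall hz)⟩
  have hc (k : ℕ) : DifferentiableOn ℂ (fun w => taylorCoeff (g w) a k) (ball b₁ s₁) :=
    differentiableOn_taylorCoeff isOpen_ball hδ k
      (fun w hw => (hgw w (hsub₁ hw)).differentiableOn) (fun z hz => (hgz z hz).mono hsub₁)
      fun r hr => ⟨n₁, fun w hw z hz => hn₁ hw z (ball_subset_ball hr.le hz)⟩
  obtain ⟨n, b, s, hs, -, hsub, hn⟩ := exists_ball_subset_of_subset_iUnion isOpen_ball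
    ⟨b₁, mem_ball_self hs₁⟩
    (S := fun n => {w | ∀ k, ‖taylorCoeff (g w) a k‖ * (2 * R) ^ k ≤ n}) (fun n => by
      have : ((↑) ⁻¹' {w | ∀ k, ‖taylorCoeff (g w) a k‖ * (2 * R) ^ k ≤ n} : Set (ball b₁ s₁)) =
          ⋂ k, {w : ball b₁ s₁ | ‖taylorCoeff (g w) a k‖ * (2 * R) ^ k ≤ n} := by ext; simp
      rw [this]
      exact isClosed_iInter fun k => isClosed_le
        ((hc k).continuousOn.domRestrict.norm.mul continuous_const) continuous_const)
    fun w hw => by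
      obtain ⟨n, hn⟩ := exists_nat_norm_le (hgw w (hsub₁ hw)).continuous a (2 * R)
      exact mem_iUnion.2 ⟨n, norm_taylorCoeff_mul_pow_le (by positivity) (lt_add_one _)
        (hgw w (hsub₁ hw)).differentiableOn hn⟩
  have hsum : ∀ w ∈ ball b s, ∀ z, HasSum (fun k => taylorCoeff (g w) a k * (z - a) ^ k) (g w z) :=
    fun w hw z => hasSum_taylorCoeff (r := dist z a + 1)
      (hgw w (hsub₁ (hsub hw))).differentiableOn (mem_ball.2 (lt_add_one _))
  have hgeom : HasSum (fun k : ℕ => (n : ℝ) * (1 / 2) ^ k) (n * 2) := hasSum_geometric_two.mul_left _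
  refine ⟨b, s, n * 2, hs, ?_, fun w hw z hz => ?_⟩
  · have hR2 : ball a R ⊆ ball a (2 * R) := ball_subset_ball (by linarith)
    refine ((differentiableOn_tsum_pow_mul isOpen_ball (fun k => (hc k).mono hsub)
      fun k p hp => hn hp k).congr fun q hq => ?_).mono (prod_mono_right hR2)
    exact (hsum q.1 hq.1 q.2).tsum_eq.symm
  · rw [← (hsum w hw z).tsum_eq]
    refine tsum_of_norm_bounded hgeom fun k => ?_
    rw [norm_mul, norm_pow]
    have h1 : ‖z - a‖ ^ k ≤ R ^ k :=
      pow_le_pow_left₀ (norm_nonneg _) (by simpa [dist_eq_norm] using (mem_ball.1 hz).le) k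
    have h2 := hn hw k
    rw [mul_pow] at h2
    rw [one_div, inv_pow, ← div_eq_mul_inv, le_div_iff₀ (by positivity)]
    calc _ ≤ ‖taylorCoeff (g w) a k‖ * R ^ k * 2 ^ k := by gcongr
      _ ≤ n := by linarith

end

section

theorem exists_measurableSet_half_volume_le {K : Set ℂ} (hK : IsCompact K) (hK0 : volume K ≠ 0)
    {S : ℕ → Set ℂ} (hmono : Monotone S) (hcov : ⋃ n, S n = K) :
    ∃ n, ENNReal.ofReal ((volume K).toReal / 2) ≤ volume (S n) := by
  have hfin : volume K ≠ ⊤ := hK.measure_lt_top.ne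
  have hpos : 0 < (volume K).toReal := ENNReal.toReal_pos hK0 hfin
  have hlim := tendsto_measure_iUnion_atTop (μ := volume) hmono
  rw [hcov] at hlim
  have hlt : ENNReal.ofReal ((volume K).toReal / 2) < volume K := by
    rw [ENNReal.ofReal_lt_iff_lt_toReal (by positivity) hfin]
    linarith
  obtain ⟨n, hn⟩ := (hlim.eventually (lt_mem_nhds hlt)).exists
  exact ⟨n, hn.le⟩

/-- A family of sequences of holomorphic functions on a disc that grows at most geometrically, and
decays faster than any geometric sequence on a smaller disc uniformly in the family, decays faster
than any geometric sequence on intermediate discs. -/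
theorem exists_norm_mul_pow_le_of_superexponential_decay {ι : Type*} {c : ι → ℕ → ℂ → ℂ} {a : ℂ}
    {δ R s M T : ℝ} (hδ : 0 < δ) (hδR : δ ≤ R) (hs : 0 < s) (hT : 0 < T)
    (hc : ∀ i k, DifferentiableOn ℂ (c i k) (ball a (3 * R)))
    (hM : ∀ i k, ∀ z ∈ ball a (3 * R), ‖c i k z‖ * s ^ k ≤ M)
    (hdecay : ∀ z ∈ ball a δ, ∀ τ > 0, ∃ n : ℕ, ∀ i k, ‖c i k z‖ * τ ^ k ≤ n) :
    ∃ C, ∀ i k, ∀ z ∈ ball a R, ‖c i k z‖ * T ^ k ≤ C := by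
  wlog hM1 : 1 ≤ M generalizing M
  · exact this (fun i k z hz => (hM i k z hz).trans (le_max_left M 1)) (le_max_right M 1)
  have hR : 0 < R := hδ.trans_le hδR
  set K := closedBall a (δ / 2) with hK
  have hKδ : K ⊆ ball a δ := closedBall_subset_ball (half_lt_self hδ)
  have hK0 : volume K ≠ 0 := (measure_closedBall_pos volume a (half_pos hδ)).ne'
  set α := (volume K).toReal / 2 with hα
  have hα0 : 0 < α :=
    half_pos (ENNReal.toReal_pos hK0 (isCompact_closedBall a (δ / 2)).measure_lt_top.ne)
  set θ := α / (2 * Real.pi * (2 * R) ^ 2) with hθ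
  have hθ0 : 0 < θ := by positivity
  set Λ := Real.log (T / s) / θ with hΛ
  have hexpΛ : Real.exp (-(θ * Λ)) = s / T := by
    rw [hΛ, mul_div_cancel₀ _ hθ0.ne', Real.exp_neg, Real.exp_log (by positivity), inv_div]
  set τ := s * Real.exp Λ with hτ
  have hτ0 : 0 < τ := by positivity
  set S : ℕ → Set ℂ := fun n => {z ∈ K | ∀ i k, ‖c i k z‖ * τ ^ k ≤ n} with hS
  have hSmono : Monotone S := fun m n hmn z hz =>
    ⟨hz.1, fun i k => (hz.2 i k).trans (Nat.cast_le.2 hmn)⟩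
  have hScov : ⋃ n, S n = K := by
    refine Subset.antisymm (iUnion_subset fun n z hz => hz.1) fun z hz => ?_
    obtain ⟨n, hn⟩ := hdecay z (hKδ hz) τ hτ0
    exact mem_iUnion.2 ⟨n, hz, hn⟩
  have hKR : K ⊆ ball a (3 * R) := hKδ.trans (ball_subset_ball (by linarith))
  have hSmeas (n : ℕ) : MeasurableSet (S n) := by
    have : S n = K ∩ ⋂ i, ⋂ k, K ∩ {z | ‖c i k z‖ * τ ^ k ≤ n} := by
      ext z
      simp only [hS, mem_inter_iff, mem_iInter, mem_ofPred_eq]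
      exact ⟨fun h => ⟨h.1, fun i k => ⟨h.1, h.2 i k⟩⟩, fun h => ⟨h.1, fun i k => (h.2 i k).2⟩⟩
    rw [this]
    refine (isClosed_closedBall.inter (isClosed_iInter fun i => isClosed_iInter fun k => ?_)).measurableSet
    exact (((hc i k).continuousOn.mono hKR).norm.mul
      continuousOn_const).preimage_isClosed_of_isClosed isClosed_closedBall isClosed_Iic
  obtain ⟨n, hn⟩ := exists_measurableSet_half_volume_le (isCompact_closedBall a (δ / 2)) hK0
    hSmono hScov
  set B : ℝ := max n 1 with hB
  have hB0 : 0 < B := lt_of_lt_of_le one_pos (le_max_right _ _)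
  refine ⟨M * Real.exp (θ * Real.log B), fun i k z hz => ?_⟩
  have hsub : ball z (2 * R) ⊆ ball a (3 * R) :=
    ball_subset_ball' (by rw [mem_ball] at hz; linarith)
  have hM0 : 0 < M := one_pos.trans_le hM1
  have key := norm_le_exp_of_small_on (g := fun x => c i k x * (s ^ k / M)) (z := z) (ρ := 2 * R)
    (L := k * Λ - Real.log B) (hSmeas n) (fun x hx => by
      have h1 := mem_ball.1 (hKδ hx.1)
      have h2 := mem_ball.1 hz
      rw [mem_ball]
      linarith [dist_triangle_right x z a]) (((hc i k).mono hsub).mul_const _) (fun x hx => by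
      rw [norm_mul, norm_div, norm_pow, Complex.norm_real, Complex.norm_real,
        Real.norm_of_nonneg hs.le, Real.norm_of_nonneg hM0.le, mul_div_assoc', div_le_one hM0]
      exact hM i k x (hsub hx)) (by positivity) hα0.le hn (fun x hx => by
      rw [norm_mul, norm_div, norm_pow, Complex.norm_real, Complex.norm_real,
        Real.norm_of_nonneg hs.le, Real.norm_of_nonneg hM0.le, mul_div_assoc', div_le_iff₀ hM0,
        neg_sub, Real.exp_sub, Real.exp_log hB0, Real.exp_nat_mul, div_mul_eq_mul_div,
        le_div_iff₀ (by positivity)]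
      have h1 := hx.2 i k
      rw [hτ, mul_pow] at h1
      have h2 : (n : ℝ) ≤ B := le_max_left _ _
      nlinarith)
  rw [norm_mul, norm_div, norm_pow, Complex.norm_real, Complex.norm_real,
    Real.norm_of_nonneg hs.le, Real.norm_of_nonneg hM0.le, mul_div_assoc', div_le_iff₀ hM0,
    ← hθ, show -(θ * (k * Λ - Real.log B)) = k * (-(θ * Λ)) + θ * Real.log B by ring,
    Real.exp_add, Real.exp_nat_mul, hexpΛ, div_pow, div_mul_eq_mul_div, div_mul_eq_mul_div,
    le_div_iff₀ (by positivity)] at key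
  have hsk : 0 < s ^ k := by positivity
  refine le_of_mul_le_mul_left ?_ hsk
  linarith

end

section

variable {E : Type*} [NormedAddCommGroup E] [NormedSpace ℂ E]

/-- A function on a cross that is holomorphic in `w` for `z` in a small disc, and entire in `z` for
`w` in an open set, extends holomorphically to products of arbitrarily large balls. -/
theorem exists_extension_ball_prod [ProperSpace E] {D : Set E} (hD : IsOpen D)
    (hne : D.Nonempty) {g : E → ℂ → ℂ} {a : ℂ} {δ : ℝ} (hδ : 0 < δ)
    (hgz : ∀ z ∈ ball a δ, Differentiable ℂ (fun w => g w z))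
    (hgw : ∀ w ∈ D, Differentiable ℂ (g w)) (b₀ : E) {R : ℝ} (hR : δ ≤ R) :
    ∃ F : E × ℂ → ℂ, DifferentiableOn ℂ F (ball b₀ R ×ˢ ball a R) ∧
      ∀ w ∈ ball b₀ R, ∀ z ∈ ball a δ, F (w, z) = g w z := by
  have hR0 : 0 < R := hδ.trans_le hR
  obtain ⟨b, s, M, hs, hdiff, hM⟩ := exists_differentiableOn_ball_prod hD hne hδ
    (fun z hz => (hgz z hz).differentiableOn) hgw (R := 3 * R) (by positivity)
  set U : Set (E × ℂ) := ball 0 1 ×ˢ ball a (3 * R) with hU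
  have hUo : IsOpen U := isOpen_ball.prod isOpen_ball
  set G : E × ℂ → ℂ → ℂ := fun p t => g (b + t • p.1) p.2 with hG
  have hmem : ∀ p ∈ U, ∀ t ∈ ball (0 : ℂ) s, b + t • p.1 ∈ ball b s := fun p hp t ht => by
    have h1 : ‖p.1‖ < 1 := by simpa using hp.1
    have h2 : ‖t‖ < s := by simpa using ht
    rw [mem_ball, dist_eq_norm, add_sub_cancel_left, norm_smul]
    nlinarith [norm_nonneg t, norm_nonneg p.1]
  have hGp : ∀ p ∈ U, DifferentiableOn ℂ (G p) (ball 0 s) := fun p hp =>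
    hdiff.comp (f := fun t : ℂ => (b + t • p.1, p.2)) (by fun_prop)
      fun t ht => ⟨hmem p hp t ht, hp.2⟩
  have hGt : ∀ t ∈ ball (0 : ℂ) s, DifferentiableOn ℂ (fun p => G p t) U := fun t ht =>
    hdiff.comp (f := fun p : E × ℂ => (b + t • p.1, p.2)) (by fun_prop)
      fun p hp => ⟨hmem p hp t ht, hp.2⟩
  have hGM : ∀ p ∈ U, ∀ t ∈ ball (0 : ℂ) s, ‖G p t‖ ≤ M := fun p hp t ht =>
    hM _ (hmem p hp t ht) _ hp.2
  have hc (k : ℕ) : DifferentiableOn ℂ (fun p => taylorCoeff (G p) 0 k) U :=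
    differentiableOn_taylorCoeff hUo hs k hGp hGt
      fun r hr => ⟨M, fun p hp t ht => hGM p hp t (ball_subset_ball hr.le ht)⟩
  have hGent : ∀ v : E, ∀ z ∈ ball a δ, Differentiable ℂ (G (v, z)) := fun v z hz =>
    (hgz z hz).comp (g := fun w => g w z) (by fun_prop : Differentiable ℂ fun t : ℂ => b + t • v)
  set T : ℝ := R + dist b b₀ with hT
  have hT0 : 0 < T := by positivity
  obtain ⟨C, hC⟩ := exists_norm_mul_pow_le_of_superexponential_decay
    (c := fun (v : ball (0 : E) 1) k z => taylorCoeff (G (v, z)) 0 k) (s := s / 2) (M := M)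
    (T := 2 * T) hδ hR (by positivity) (by positivity)
    (fun v k => (hc k).comp (f := fun z : ℂ => ((v : E), z)) (by fun_prop)
      fun z hz => ⟨v.2, hz⟩)
    (fun v k z hz => norm_taylorCoeff_mul_pow_le (half_pos hs) (half_lt_self hs)
      (hGp _ ⟨v.2, hz⟩)
      (fun t ht => hGM _ ⟨v.2, hz⟩ t (closedBall_subset_ball (half_lt_self hs) ht)) k)
    (fun z hz τ hτ => by
      obtain ⟨n, hn⟩ := exists_nat_norm_le (hgz z hz).continuous b τ
      refine ⟨n, fun v k => norm_taylorCoeff_mul_pow_le hτ (lt_add_one τ)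
        (hGent v z hz).differentiableOn (fun t ht => hn _ ?_) k⟩
      have h1 : ‖(v : E)‖ < 1 := mem_ball_zero_iff.1 v.2
      have h2 : ‖t‖ ≤ τ := by simpa using ht
      rw [mem_closedBall, dist_eq_norm, add_sub_cancel_left, norm_smul]
      nlinarith [norm_nonneg t, norm_nonneg (v : E)])
  have hTC : (T : ℂ) ≠ 0 := by exact_mod_cast hT0.ne'
  have hv : ∀ w ∈ ball b₀ R, (T : ℂ)⁻¹ • (w - b) ∈ ball (0 : E) 1 := fun w hw => by
    rw [mem_ball_zero_iff, norm_smul, norm_inv, Complex.norm_real, Real.norm_of_nonneg hT0.le,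
      inv_mul_lt_one₀ hT0, ← dist_eq_norm]
    have := dist_triangle_right w b b₀
    rw [mem_ball] at hw
    linarith
  refine ⟨fun q => ∑' k, taylorCoeff (G ((T : ℂ)⁻¹ • (q.1 - b), q.2)) 0 k * (T : ℂ) ^ k,
    differentiableOn_tsum_of_norm_le (isOpen_ball.prod isOpen_ball)
      (u := fun k => C * (1 / 2) ^ k) (summable_geometric_two.mul_left C) (fun k => ?_) ?_, ?_⟩
  · refine DifferentiableOn.mul_const ?_ _
    exact (hc k).comp (f := fun q : E × ℂ => ((T : ℂ)⁻¹ • (q.1 - b), q.2)) (by fun_prop)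
      fun q hq => ⟨hv _ hq.1, ball_subset_ball (by linarith) hq.2⟩
  · intro k q hq
    have := hC ⟨_, hv _ hq.1⟩ k q.2 hq.2
    rw [norm_mul, norm_pow, Complex.norm_real, Real.norm_of_nonneg hT0.le, one_div, inv_pow,
      ← div_eq_mul_inv, le_div_iff₀ (by positivity)]
    rw [mul_pow] at this
    linarith
  · intro w hw z hz
    have := (hasSum_taylorCoeff (a := 0) (z := (T : ℂ)) (r := ‖(T : ℂ)‖ + 1)
      (hGent ((T : ℂ)⁻¹ • (w - b)) z hz).differentiableOn (by simp)).tsum_eq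
    simp only [sub_zero] at this
    refine this.trans ?_
    simp only [hG, smul_inv_smul₀ hTC, add_sub_cancel]

/-- The identity theorem for entire functions on a complex normed space. -/
theorem Differentiable.eq_of_eqOn_isOpen {f g : E → ℂ} (hf : Differentiable ℂ f)
    (hg : Differentiable ℂ g) {V : Set E} (hV : IsOpen V) (hne : V.Nonempty) (hfg : EqOn f g V) :
    f = g := by
  obtain ⟨x₀, hx₀⟩ := hne
  funext x
  have hl : Differentiable ℂ fun t : ℂ => x₀ + t • (x - x₀) := by fun_prop
  have hf' : AnalyticOnNhd ℂ (fun t : ℂ => f (x₀ + t • (x - x₀))) univ :=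
    (hf.comp hl).differentiableOn.analyticOnNhd isOpen_univ
  have hg' : AnalyticOnNhd ℂ (fun t : ℂ => g (x₀ + t • (x - x₀))) univ :=
    (hg.comp hl).differentiableOn.analyticOnNhd isOpen_univ
  have hev : ∀ᶠ t in 𝓝 (0 : ℂ), x₀ + t • (x - x₀) ∈ V :=
    hl.continuous.continuousAt.eventually (hV.mem_nhds (by simpa using hx₀))
  have := hf'.eqOn_of_preconnected_of_eventuallyEq hg' isPreconnected_univ (mem_univ 0)
    (hev.mono fun t ht => hfg ht) (mem_univ 1)
  simpa using this

/-- The cross theorem for two factors, one of which is one-dimensional. -/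
theorem exists_entire_extension_prod [ProperSpace E] {D : Set E} (hD : IsOpen D)
    (hne : D.Nonempty) {D₀ : Set ℂ} (hD₀ : IsOpen D₀) (hne₀ : D₀.Nonempty) {g : E → ℂ → ℂ}
    (hgz : ∀ z ∈ D₀, Differentiable ℂ (fun w => g w z))
    (hgw : ∀ w ∈ D, Differentiable ℂ (g w)) :
    ∃ F : E × ℂ → ℂ, Differentiable ℂ F ∧ ∀ w ∈ D, ∀ z, F (w, z) = g w z := by
  obtain ⟨a, ha⟩ := hne₀
  obtain ⟨δ, hδ, hδD⟩ := Metric.isOpen_iff.1 hD₀ a ha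
  have hext (n : ℕ) := exists_extension_ball_prod hD hne hδ (fun z hz => hgz z (hδD hz)) hgw 0
    (le_add_of_nonneg_left n.cast_nonneg : δ ≤ (n : ℝ) + δ)
  choose F hF hFg using hext
  set Ω : ℕ → Set (E × ℂ) := fun n => ball 0 (n + δ) ×ˢ ball a (n + δ) with hΩ
  have hagree : ∀ m n, m ≤ n → ∀ q ∈ Ω m, F m q = F n q := by
    rintro m n hmn ⟨w, z⟩ ⟨hw, hz⟩
    have hle : (m : ℝ) + δ ≤ n + δ := by gcongr
    have hsl : ∀ k : ℕ, w ∈ ball (0 : E) (k + δ) →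
        AnalyticOnNhd ℂ (fun z => F k (w, z)) (ball a (k + δ)) := fun k hk =>
      ((hF k).comp (f := fun z : ℂ => (w, z)) (by fun_prop)
        fun z hz => ⟨hk, hz⟩).analyticOnNhd isOpen_ball
    have hw' := ball_subset_ball hle hw
    refine (hsl m hw).eqOn_of_preconnected_of_eventuallyEq
      ((hsl n hw').mono (ball_subset_ball hle)) (convex_ball _ _).isPreconnected
      (mem_ball_self (by positivity)) ?_ hz
    filter_upwards [ball_mem_nhds a hδ] with y hy
    rw [hFg m w hw y hy, hFg n w hw' y hy]
  have hcover (q : E × ℂ) : ∃ n, q ∈ Ω n := by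
    obtain ⟨n, hn⟩ := exists_nat_ge (max (dist q.1 0) (dist q.2 a))
    exact ⟨n, mem_ball.2 (by linarith [le_max_left (dist q.1 0) (dist q.2 a)]),
      mem_ball.2 (by linarith [le_max_right (dist q.1 0) (dist q.2 a)])⟩
  choose N hN using hcover
  have heq : ∀ n, ∀ q ∈ Ω n, F (N q) q = F n q := fun n q hq => by
    rcases le_total (N q) n with h | h
    · exact hagree _ _ h q (hN q)
    · exact (hagree _ _ h q hq).symm
  have hdiff : Differentiable ℂ fun q => F (N q) q := fun q => by
    have hnhds : Ω (N q) ∈ 𝓝 q := (isOpen_ball.prod isOpen_ball).mem_nhds (hN q)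
    refine ((hF (N q)).differentiableAt hnhds).congr_of_eventuallyEq ?_
    filter_upwards [hnhds] with p hp using heq _ p hp
  refine ⟨fun q => F (N q) q, hdiff, fun w hw z => ?_⟩
  refine congrFun (f := fun z => F (N (w, z)) (w, z)) ?_ z
  refine Differentiable.eq_of_eqOn_isOpen (f := fun z => F (N (w, z)) (w, z))
    (hdiff.comp (by fun_prop : Differentiable ℂ fun z : ℂ => (w, z))) (hgw w hw)
    isOpen_ball ⟨a, mem_ball_self hδ⟩ fun z hz => ?_
  obtain ⟨n, hn⟩ := exists_nat_gt (dist w 0)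
  have hw : w ∈ ball (0 : E) (n + δ) := mem_ball.2 (by linarith)
  exact (heq n (w, z) ⟨hw, ball_subset_ball (by simp) hz⟩).trans (hFg n w hw z hz)

end

/-- The cross theorem for finitely many one-dimensional factors indexed by `Fin m`. -/
theorem exists_entire_extension_fin (m : ℕ) (D : Fin m → Set ℂ) (hD : ∀ i, IsOpen (D i))
    (hne : ∀ i, (D i).Nonempty) (f : (Fin m → ℂ) → ℂ)
    (hf : ∀ j a, (∀ i, i ≠ j → a i ∈ D i) → Differentiable ℂ fun ζ => f (Function.update a j ζ)) :
    ∃ F : (Fin m → ℂ) → ℂ, Differentiable ℂ F ∧ ∀ x, (∀ i, x i ∈ D i) → F x = f x := by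
  classical
  induction m with
  | zero => exact ⟨f, fun x => (hasFDerivAt_of_subsingleton f x).differentiableAt, fun _ _ => rfl⟩
  | succ m ih =>
    have hslice : ∀ z ∈ D 0, ∃ F : (Fin m → ℂ) → ℂ, Differentiable ℂ F ∧
        ∀ w, (∀ i, w i ∈ D i.succ) → F w = f (Fin.cons z w) := fun z hz => by
      refine ih (fun i => D i.succ) (fun i => hD _) (fun i => hne _) (fun w => f (Fin.cons z w))
        fun j a ha => ?_
      simp only [Fin.cons_update]
      refine hf j.succ (Fin.cons z a) fun i hi => ?_
      cases i using Fin.cases with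
      | zero => simpa using hz
      | succ i => simpa using ha i fun h => hi (h ▸ rfl)
    choose! F hF hFf using hslice
    obtain ⟨G, hG, hGg⟩ := exists_entire_extension_prod
      (D := univ.pi fun i : Fin m => D i.succ) (isOpen_set_pi finite_univ fun i _ => hD _)
      (univ_pi_nonempty_iff.2 fun i => hne _) (hD 0) (hne 0)
      (g := fun w z => if ∀ i, w i ∈ D i.succ then f (Fin.cons z w) else F z w)
      (fun z hz => by
        refine (congrArg (Differentiable ℂ) (funext fun w => ?_)).mp (hF z hz)
        split_ifs with h
        exacts [hFf z hz w h, rfl])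
      (fun w hw => by
        have hw' : ∀ i, w i ∈ D i.succ := fun i => hw i (mem_univ i)
        simp only [hw', implies_true, if_true]
        have := hf 0 (Fin.cons 0 w) fun i hi => by
          cases i using Fin.cases with
          | zero => exact absurd rfl hi
          | succ i => simpa using hw' i
        simpa only [Fin.update_cons_zero] using this)
    refine ⟨fun x => G (Fin.tail x, x 0), hG.comp ?_, fun x hx => ?_⟩
    · exact (differentiable_pi.2 fun i => differentiable_apply i.succ).prodMk
        (differentiable_apply 0)
    · refine (hGg (Fin.tail x) (fun i _ => hx i.succ) (x 0)).trans ?_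
      have hx' : ∀ i, Fin.tail x i ∈ D i.succ := fun i => hx i.succ
      rw [if_pos hx', Fin.cons_self_tail]

/-- The cross theorem for a finite family of one-dimensional factors. -/
theorem exists_entire_extension_pi {ι : Type*} [Fintype ι] [DecidableEq ι] (D : ι → Set ℂ)
    (hD : ∀ i, IsOpen (D i)) (hne : ∀ i, (D i).Nonempty) (f : (ι → ℂ) → ℂ)
    (hf : ∀ j a, (∀ i, i ≠ j → a i ∈ D i) → Differentiable ℂ fun ζ => f (Function.update a j ζ)) :
    ∃ F : (ι → ℂ) → ℂ, Differentiable ℂ F ∧ ∀ x, (∀ i, x i ∈ D i) → F x = f x := by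
  let e := Fintype.equivFin ι
  obtain ⟨F, hF, hFf⟩ := exists_entire_extension_fin _ (fun i => D (e.symm i)) (fun i => hD _)
    (fun i => hne _) (fun x => f (x ∘ e)) fun j a ha => by
      have := hf (e.symm j) (a ∘ e) fun i hi => by
        simpa using ha (e i) fun h => hi (by simp [← h])
      simpa only [Function.update_comp_equiv] using this
  refine ⟨fun x => F (x ∘ e.symm), hF.comp ?_, fun x hx => ?_⟩
  · exact differentiable_pi.2 fun i => differentiable_apply (e.symm i)
  · refine (hFf (x ∘ e.symm) fun i => hx _).trans ?_
    congr 1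
    ext i
    simp

variable {ι : Type*} [Fintype ι] [DecidableEq ι] {n : ι → ℕ} {A : ∀ j, Set (Fin (n j) → ℂ)}
  {f : (∀ j, Fin (n j) → ℂ) → ℂ}

/-- A separately holomorphic function on a cross with factors `ℂ^{n_j}` agrees with an entire
function on the whole cross. -/
theorem exists_entire_eq_on_cross (hAne : ∀ j, (A j).Nonempty) (hAo : ∀ j, IsOpen (A j))
    (hf : ∀ j, ∀ a : ∀ i, Fin (n i) → ℂ, (∀ i, i ≠ j → a i ∈ A i) →
      Differentiable ℂ (fun zj : Fin (n j) → ℂ => f (Function.update a j zj))) :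
    ∃ F : (∀ j, Fin (n j) → ℂ) → ℂ, Differentiable ℂ F ∧
      ∀ j z, (∀ i, i ≠ j → z i ∈ A i) → F z = f z := by
  choose p hp using hAne
  have hball (j) : ∃ r > 0, ball (p j) r ⊆ A j := Metric.isOpen_iff.1 (hAo j) _ (hp j)
  choose r hr hrA using hball
  obtain ⟨F, hF, hFf⟩ := exists_entire_extension_pi
    (fun s : Σ j, Fin (n j) => ball (p s.1 s.2) (r s.1)) (fun s => isOpen_ball)
    (fun s => ⟨_, mem_ball_self (hr s.1)⟩) (fun x => f (Sigma.curry x)) (by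
      rintro ⟨j, k⟩ a ha
      have hj := hf j (Sigma.curry a) fun i hi => hrA i (by
        rw [ball_pi _ (hr i)]
        exact fun l _ => ha ⟨i, l⟩ fun h => hi (congrArg Sigma.fst h))
      have hk : Differentiable ℂ (Function.update (fun l => a ⟨j, l⟩) k : ℂ → Fin (n j) → ℂ) :=
        fun ζ => (hasFDerivAt_update (E := fun _ => ℂ) _ ζ).differentiableAt
      have := hj.comp hk
      simp only [Sigma.curry_update]
      exact this)
  have hFd : Differentiable ℂ fun z : ∀ j, Fin (n j) → ℂ => F fun s => z s.1 s.2 :=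
    hF.comp (f := fun (z : ∀ j, Fin (n j) → ℂ) (s : Σ j, Fin (n j)) => z s.1 s.2)
      (differentiable_pi.2 fun s => by fun_prop)
  have key : ∀ s : Finset ι, ∀ j z, (∀ i, i ≠ j → z i ∈ A i) →
      (∀ i, i ∉ s → z i ∈ ball (p i) (r i)) → F (fun t => z t.1 t.2) = f z := by
    intro s
    induction s using Finset.strongInduction with
    | H s ih =>
      intro j z hz hs
      by_cases hall : ∀ i, z i ∈ ball (p i) (r i)
      · refine hFf _ fun t => ?_
        have := hall t.1
        rw [ball_pi _ (hr _)] at this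
        exact this t.2 (mem_univ _)
      obtain ⟨k, hk, hzk⟩ : ∃ k, z k ∉ ball (p k) (r k) ∧ ∀ i, i ≠ k → z i ∈ A i := by
        by_cases hj : z j ∈ ball (p j) (r j)
        · obtain ⟨k, hk⟩ := not_forall.1 hall
          refine ⟨k, hk, fun i _ => ?_⟩
          rcases eq_or_ne i j with rfl | h
          exacts [hrA _ hj, hz i h]
        · exact ⟨j, hj, hz⟩
      have hks : k ∈ s := by_contra fun h => hk (hs k h)
      have heq := Differentiable.eq_of_eqOn_isOpen
        (hFd.comp (f := Function.update z k)
          fun y => (hasFDerivAt_update z y).differentiableAt) (hf k z hzk) isOpen_ball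
        ⟨_, mem_ball_self (hr k)⟩ fun y hy => by
          refine ih (s.erase k) (Finset.erase_ssubset hks) k (Function.update z k y)
            (fun i hi => by simpa [hi] using hzk i hi) fun i hi => ?_
          rcases eq_or_ne i k with rfl | h
          · simpa using hy
          · rw [Function.update_of_ne h]
            exact hs i fun his => hi (Finset.mem_erase.2 ⟨h, his⟩)
      simpa using congrFun heq (z k)
  exact ⟨_, hFd, fun j z hz =>
    key Finset.univ j z hz fun i hi => absurd (Finset.mem_univ i) hi⟩

/-- An entire function bounded on the cross over nonempty open sets is constant. -/
theorem Differentiable.eq_const_of_bounded_on_cross {F : (∀ j, Fin (n j) → ℂ) → ℂ}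
    (hF : Differentiable ℂ F) (hAo : ∀ j, IsOpen (A j)) {M : ℝ}
    (hM : ∀ j z, (∀ i, i ≠ j → z i ∈ A i) → ‖F z‖ ≤ M) {p : ∀ j, Fin (n j) → ℂ}
    (hp : ∀ j, p j ∈ A j) (z : ∀ j, Fin (n j) → ℂ) : F z = F p := by
  have hupd : ∀ (w : ∀ j, Fin (n j) → ℂ), (∀ i, w i ∈ A i) → ∀ j y y',
      F (Function.update w j y) = F (Function.update w j y') := fun w hw j y y' =>
    (hF.comp (f := Function.update w j)
        fun y => (hasFDerivAt_update w y).differentiableAt).apply_eq_apply_of_bounded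
      (isBounded_iff_forall_norm_le.2 ⟨M, by
        rintro _ ⟨v, rfl⟩
        exact hM j _ fun i hi => by simpa [hi] using hw i⟩) y y'
  refine congrFun (Differentiable.eq_of_eqOn_isOpen hF (differentiable_const (F p))
    (isOpen_set_pi finite_univ fun i _ => hAo i) ⟨p, fun i _ => hp i⟩ fun w hw => ?_) z
  have hs : ∀ s : Finset ι, F (s.piecewise w p) = F p := fun s => by
    induction s using Finset.induction with
    | empty => simp
    | insert j s _ ih =>
      have := hupd (s.piecewise w p) (fun i => by
        by_cases h : i ∈ s
        · simpa [h] using hw i (mem_univ i)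
        · simpa [h] using hp i) j (w j) (s.piecewise w p j)
      rw [Finset.piecewise_insert, this, Function.update_eq_self, ih]
  simpa using hs Finset.univ

end

/-- Classical cross theorem in the case `D_j = ℂ^{n_j}` with `A_j ⊆ ℂ^{n_j}` nonempty open:
every separately holomorphic function on the `N`-fold cross
`X = ⋃_j A_1 × ⋯ × A_{j-1} × ℂ^{n_j} × A_{j+1} × ⋯ × A_N` extends uniquely to an entire
function `F` on `ℂ^{n_1 + ⋯ + n_N}`, with `sup |F| = sup_X |f|`. -/
theorem classical_cross_theorem_entire (N : ℕ) (hN : 2 ≤ N) (n : Fin N → ℕ)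
    (A : ∀ j, Set (Fin (n j) → ℂ)) (hAne : ∀ j, (A j).Nonempty) (hAo : ∀ j, IsOpen (A j))
    (X : Set (∀ j, Fin (n j) → ℂ))
    (hX : X = ⋃ j : Fin N, {z : ∀ i, Fin (n i) → ℂ | ∀ i, i ≠ j → z i ∈ A i})
    (f : (∀ j, Fin (n j) → ℂ) → ℂ)
    (hf : ∀ j : Fin N, ∀ a : ∀ i, Fin (n i) → ℂ, (∀ i, i ≠ j → a i ∈ A i) →
      Differentiable ℂ (fun zj : Fin (n j) → ℂ => f (Function.update a j zj))) :
    ∃ F : (∀ j, Fin (n j) → ℂ) → ℂ, Differentiable ℂ F ∧ Set.EqOn F f X ∧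
      (⨆ z : ∀ j, Fin (n j) → ℂ, (‖F z‖₊ : ENNReal)) = (⨆ z ∈ X, (‖f z‖₊ : ENNReal)) ∧
      ∀ G : (∀ j, Fin (n j) → ℂ) → ℂ, Differentiable ℂ G → Set.EqOn G f X → G = F := by
  have hcross : ∀ z, z ∈ X ↔ ∃ j, ∀ i, i ≠ j → z i ∈ A i := fun z => by simp [hX]
  obtain ⟨F, hF, hFf⟩ := exists_entire_eq_on_cross hAne hAo hf
  have hFX : Set.EqOn F f X := fun z hz => by
    obtain ⟨j, hj⟩ := (hcross z).1 hz
    exact hFf j z hj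
  choose p hp using hAne
  let j₀ : Fin N := ⟨0, by omega⟩
  refine ⟨F, hF, hFX, le_antisymm ?_ ?_, fun G hG hGf => ?_⟩
  · by_cases htop : (⨆ z ∈ X, (‖f z‖₊ : ENNReal)) = ⊤
    · exact htop ▸ le_top
    have hbound : ∀ z ∈ X, (‖f z‖₊ : ENNReal) ≤ ⨆ z ∈ X, (‖f z‖₊ : ENNReal) := fun z hz =>
      le_iSup₂ (f := fun z (_ : z ∈ X) => (‖f z‖₊ : ENNReal)) z hz
    refine iSup_le fun z => ?_
    have hpX : p ∈ X := (hcross p).2 ⟨j₀, fun i _ => hp i⟩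
    rw [hF.eq_const_of_bounded_on_cross hAo
      (M := (⨆ z ∈ X, (‖f z‖₊ : ENNReal)).toReal) (fun j w hw => ?_) hp z, hFX hpX]
    · exact hbound p hpX
    · rw [hFf j w hw]
      simpa using ENNReal.toReal_mono htop (hbound w ((hcross w).2 ⟨j, hw⟩))
  · refine iSup₂_le fun z hz => ?_
    rw [← hFX hz]
    exact le_iSup (fun z => (‖F z‖₊ : ENNReal)) z
  · exact hG.eq_of_eqOn_isOpen hF (isOpen_set_pi Set.finite_univ fun i _ => hAo i)
      ⟨p, fun i _ => hp i⟩ fun z hz => by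
        have hzX : z ∈ X := (hcross z).2 ⟨j₀, fun i _ => hz i (Set.mem_univ i)⟩
        rw [hGf hzX, hFX hzX]
end

section
/- Let N ≥ 2 and 1 ≤ k ≤ N be integers, and for j = 1,…,N let A_j ⊆ ℂ^{n_j} be a nonempty open set. Let X_{N,k} be the (N,k)-cross formed from the pairs (A_j, ℂ^{n_j}), and let f : X_{N,k} → ℂ be separately holomorphic on X_{N,k}. Then there exists exactly one entire function F : ℂ^{n_1 + ⋯ + n_N} → ℂ such that F = f on X_{N,k}, and moreover sup_{ℂ^{n_1+⋯+n_N}} |F| = sup_{X_{N,k}} |f|. -/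
open Finset in
/-- A set of reals of outer measure larger than `N * h` contains `N + 1` points that are
`h`-separated. -/
theorem exists_separated_of_lt_volume (h : ℝ) (hh : 0 ≤ h) (N : ℕ) : ∀ E : Set ℝ, BddBelow E →
    ENNReal.ofReal (N * h) < MeasureTheory.volume E →
    ∃ x : ℕ → ℝ, (∀ i ≤ N, x i ∈ E) ∧
      ∀ i j, i ≤ j → j ≤ N → ((j : ℝ) - i) * h ≤ x j - x i := by
  induction N with
  | zero =>
    intro E _ hE
    have hne : E.Nonempty := by
      rw [Set.nonempty_iff_ne_empty]
      rintro rfl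
      simp at hE
    obtain ⟨y, hy⟩ := hne
    refine ⟨fun _ => y, fun _ _ => hy, fun i j hij hj => ?_⟩
    obtain rfl : j = 0 := by omega
    obtain rfl : i = 0 := by omega
    simp
  | succ N ih =>
    intro E hb hE
    have hne : E.Nonempty := by
      rw [Set.nonempty_iff_ne_empty]
      rintro rfl
      simp at hE
    obtain ⟨t, ht1, ht2⟩ := ENNReal.lt_iff_exists_real_btwn.1 hE |>.imp fun t ht => ht.2
    have ht0 : ((N + 1 : ℕ) : ℝ) * h < t := by
      by_contra! hcon
      exact absurd (ENNReal.ofReal_le_ofReal hcon) (not_le.2 ht1)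
    obtain ⟨y, hyE, hy⟩ := exists_lt_of_csInf_lt hne
      (show sInf E < sInf E + (t - (N + 1 : ℕ) * h) by linarith)
    have hsub : E ⊆ (E ∩ Set.Ici (y + h)) ∪ Set.Ico (sInf E) (y + h) := by
      intro u hu
      rcases le_or_gt (y + h) u with h1 | h1
      · exact Or.inl ⟨hu, h1⟩
      · exact Or.inr ⟨csInf_le hb hu, h1⟩
    have hmeas := (MeasureTheory.measure_mono hsub).trans
      (MeasureTheory.measure_union_le (μ := MeasureTheory.volume) _ _)
    rw [Real.volume_Ico] at hmeas
    have hE' : ENNReal.ofReal (N * h) < MeasureTheory.volume (E ∩ Set.Ici (y + h)) := by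
      by_contra! hcon
      have h1 := ht2.trans_le (hmeas.trans (add_le_add_left hcon _))
      rw [← ENNReal.ofReal_add (by positivity)
        (by linarith [csInf_le hb hyE])] at h1
      refine absurd h1 (not_lt.2 (ENNReal.ofReal_le_ofReal ?_))
      push_cast at hy
      nlinarith
    obtain ⟨x, hx1, hx2⟩ := ih _ (hb.mono Set.inter_subset_left) hE'
    refine ⟨fun i => Nat.casesOn i y x, ?_, ?_⟩
    · rintro (_ | i) hi
      · exact hyE
      · exact (hx1 i (by omega)).1
    · rintro (_ | i) (_ | j) hij hj
      · simp
      · have h1 := hx2 0 j (Nat.zero_le _) (by omega)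
        have h2 : y + h ≤ x 0 := (hx1 0 (Nat.zero_le _)).2
        change (((j + 1 : ℕ) : ℝ) - (0 : ℕ)) * h ≤ x j - y
        push_cast at h1 ⊢
        linarith
      · omega
      · have h1 := hx2 i j (by omega) (by omega)
        push_cast
        simpa using h1

/-- The product of the distances from `i` to the other elements of `{0, …, N}`. -/
theorem prod_abs_sub_range_erase (i N : ℕ) (hi : i ≤ N) :
    ∏ j ∈ (Finset.range (N + 1)).erase i, |(i : ℝ) - j| = (i.factorial * (N - i).factorial : ℕ) := by
  induction N, hi using Nat.le_induction with
  | base =>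
    rw [Finset.range_add_one, Finset.erase_insert (by simp), ← Finset.prod_range_reflect,
      Nat.sub_self, Nat.factorial_zero, mul_one, ← Finset.prod_range_add_one_eq_factorial]
    push_cast
    refine Finset.prod_congr rfl fun j hj => ?_
    have hj' : j < i := Finset.mem_range.1 hj
    have : ((i - 1 - j : ℕ) : ℝ) = i - 1 - j := by
      rw [Nat.cast_sub (by omega), Nat.cast_sub (by omega)]; simp
    rw [this, show (i : ℝ) - (i - 1 - j) = j + 1 by ring, abs_of_nonneg (by positivity)]
  | succ N hN ih =>
    rw [Finset.range_add_one, Finset.erase_insert_of_ne (by omega), Finset.prod_insert (by simp),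
      ih, Nat.succ_sub hN, Nat.factorial_succ, abs_sub_comm]
    have : ((N + 1 : ℕ) : ℝ) - i = ((N - i + 1 : ℕ) : ℝ) := by
      push_cast [Nat.cast_sub hN]; ring
    rw [this, abs_of_nonneg (by positivity)]
    push_cast
    ring

/-- `x 0, …, x N` are increasing points of `[0, 1]` with consecutive gaps comparable to `1 / N`. -/
def WellSpaced (N : ℕ) (x : ℕ → ℝ) : Prop :=
  (∀ i ≤ N, x i ∈ Set.Icc (0 : ℝ) 1) ∧
    ∀ i j, i ≤ j → j ≤ N → ((j : ℝ) - i) * (2 * ((N : ℝ) + 1))⁻¹ ≤ x j - x i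

theorem WellSpaced.abs_sub_le {N : ℕ} {x : ℕ → ℝ} (hx : WellSpaced N x) {i j : ℕ} (hi : i ≤ N)
    (hj : j ≤ N) : |(i : ℝ) - j| * (2 * ((N : ℝ) + 1))⁻¹ ≤ |x i - x j| := by
  rcases le_total i j with h | h
  · rw [abs_sub_comm, abs_sub_comm (x i), abs_of_nonneg (by simpa using h)]
    exact (hx.2 i j h hj).trans (le_abs_self _)
  · rw [abs_of_nonneg (by simpa using h)]
    exact (hx.2 j i h hi).trans (le_abs_self _)

theorem WellSpaced.injOn {N : ℕ} {x : ℕ → ℝ} (hx : WellSpaced N x) :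
    Set.InjOn (fun j => (x j : ℂ)) (Finset.range (N + 1)) := by
  intro i hi j hj hij
  simp only [Finset.coe_range, Set.mem_Iio, Nat.lt_succ_iff, Complex.ofReal_inj] at hi hj hij
  have h := hx.abs_sub_le hi hj
  rw [hij, sub_self, abs_zero] at h
  have h2 : |(i : ℝ) - j| ≤ 0 := by
    by_contra! hcon
    have : 0 < |(i : ℝ) - j| * (2 * ((N : ℝ) + 1))⁻¹ := by positivity
    linarith
  have := sub_eq_zero.1 (abs_nonpos_iff.1 h2)
  exact_mod_cast this

theorem wellSpaced_equidistant (N : ℕ) : WellSpaced N fun i => (i : ℝ) / (N + 1) := by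
  refine ⟨fun i hi => ⟨by positivity, ?_⟩, fun i j hij hj => ?_⟩
  · rw [div_le_one (by positivity)]
    have : (i : ℝ) ≤ N := by exact_mod_cast hi
    linarith
  · have : (0 : ℝ) ≤ j - i := by simpa using hij
    rw [← sub_div, div_eq_mul_inv]
    gcongr
    linarith

/-- The value at `w` of the `i`-th Lagrange basis polynomial for the nodes `x 0, …, x N`. -/
noncomputable def lagrangeBasis (N : ℕ) (x : ℕ → ℝ) (i : ℕ) (w : ℂ) : ℂ :=
  (Lagrange.basis (Finset.range (N + 1)) (fun j => (x j : ℂ)) i).eval w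

theorem differentiable_lagrangeBasis (N : ℕ) (x : ℕ → ℝ) (i : ℕ) :
    Differentiable ℂ (lagrangeBasis N x i) :=
  Polynomial.differentiable _

theorem WellSpaced.norm_lagrangeBasis_le {N : ℕ} {x : ℕ → ℝ} (hx : WellSpaced N x) {i : ℕ}
    (hi : i ≤ N) {R : ℝ} {w : ℂ} (hw : ‖w‖ ≤ R) :
    ‖lagrangeBasis N x i w‖ ≤
      (2 * (N + 1) * (R + 1)) ^ N * ((i.factorial * (N - i).factorial : ℕ) : ℝ)⁻¹ := by
  have hR : 0 ≤ R := (norm_nonneg _).trans hw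
  have hcard : ((Finset.range (N + 1)).erase i).card = N := by
    rw [Finset.card_erase_of_mem (by simp; omega)]; simp
  rw [← prod_abs_sub_range_erase i N hi, lagrangeBasis, Lagrange.basis, Polynomial.eval_prod,
    norm_prod, ← Finset.prod_inv_distrib]
  nth_rw 3 [← hcard]
  rw [← Finset.prod_const, ← Finset.prod_mul_distrib]
  refine Finset.prod_le_prod (fun _ _ => norm_nonneg _) fun j hj => ?_
  obtain ⟨hji, hj⟩ := Finset.mem_erase.1 hj
  have hj' : j ≤ N := by simpa [Nat.lt_succ_iff] using hj
  have hpos : 0 < |(i : ℝ) - j| := by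
    rw [abs_pos, sub_ne_zero]; exact_mod_cast hji.symm
  have h1 := hx.abs_sub_le hi hj'
  have h2 : ‖w - (x j : ℂ)‖ ≤ R + 1 := by
    refine (norm_sub_le _ _).trans (add_le_add hw ?_)
    rw [Complex.norm_real, Real.norm_eq_abs, abs_of_nonneg (hx.1 j hj').1]
    exact (hx.1 j hj').2
  simp only [Lagrange.basisDivisor, Polynomial.eval_mul, Polynomial.eval_C, Polynomial.eval_sub,
    Polynomial.eval_X, norm_mul, norm_inv]
  rw [← Complex.ofReal_sub, Complex.norm_real, Real.norm_eq_abs]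
  have h3 : (|x i - x j|)⁻¹ ≤ (|(i : ℝ) - j| * (2 * ((N : ℝ) + 1))⁻¹)⁻¹ := by gcongr
  calc _ ≤ (|(i : ℝ) - j| * (2 * ((N : ℝ) + 1))⁻¹)⁻¹ * (R + 1) := by gcongr
    _ = _ := by rw [mul_inv, inv_inv]; ring

/-- The Lebesgue constant of well spaced nodes grows at most geometrically. -/
theorem WellSpaced.sum_norm_lagrangeBasis_le {N : ℕ} {x : ℕ → ℝ} (hx : WellSpaced N x)
    {R : ℝ} {w : ℂ} (hw : ‖w‖ ≤ R) :
    ∑ i ∈ Finset.range (N + 1), ‖lagrangeBasis N x i w‖ ≤ 3 * (12 * (R + 1)) ^ N := by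
  have hR : 0 ≤ R := (norm_nonneg _).trans hw
  have h1 : ∀ i ∈ Finset.range (N + 1), ‖lagrangeBasis N x i w‖ ≤
      (2 * (N + 1) * (R + 1)) ^ N * (N.factorial : ℝ)⁻¹ * (N.choose i : ℝ) := by
    intro i hi
    have hi' : i ≤ N := by simpa [Nat.lt_succ_iff] using hi
    refine (hx.norm_lagrangeBasis_le hi' hw).trans_eq ?_
    rw [Nat.cast_choose ℝ hi']
    have : (N.factorial : ℝ) ≠ 0 := by positivity
    push_cast
    field_simp
  refine (Finset.sum_le_sum h1).trans ?_
  rw [← Finset.mul_sum]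
  have h2 : ∑ i ∈ Finset.range (N + 1), (N.choose i : ℝ) = 2 ^ N := by
    exact_mod_cast Nat.sum_range_choose N
  have h3 : ((N : ℝ) + 1) ^ N * (N.factorial : ℝ)⁻¹ ≤ 3 ^ (N + 1) := by
    rw [← div_eq_mul_inv]
    refine (Real.pow_div_factorial_le_exp _ (by positivity) N).trans ?_
    rw [show (N : ℝ) + 1 = ((N + 1 : ℕ) : ℝ) * 1 by push_cast; ring, Real.exp_nat_mul]
    gcongr
    linarith [Real.exp_one_lt_d9]
  rw [h2]
  calc _ = (4 * (R + 1)) ^ N * (((N : ℝ) + 1) ^ N * (N.factorial : ℝ)⁻¹) := by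
        rw [show (4 : ℝ) = 2 * 2 by norm_num]; simp only [mul_pow]; ring
    _ ≤ (4 * (R + 1)) ^ N * 3 ^ (N + 1) := by gcongr
    _ = _ := by rw [show (12 : ℝ) = 4 * 3 by norm_num]; simp only [mul_pow]; ring

/-- Taylor coefficients of an entire function, together with the Cauchy estimates. -/
theorem Differentiable.exists_coeff_hasSum {q : ℂ → ℂ} (hq : Differentiable ℂ q) :
    ∃ c : ℕ → ℂ, (∀ w, HasSum (fun k => c k * w ^ k) (q w)) ∧
      ∀ S m : ℝ, 0 < S → (∀ w, ‖w‖ ≤ S → ‖q w‖ ≤ m) → ∀ k, ‖c k‖ ≤ m / S ^ k := by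
  refine ⟨fun k => (k.factorial : ℂ)⁻¹ * iteratedDeriv k q 0, fun w => ?_, fun S m hS hm k => ?_⟩
  · convert! Complex.hasSum_taylorSeries_of_entire hq 0 w using 2 with k
    simp only [smul_eq_mul, sub_zero]
    ring
  · have h := Complex.norm_iteratedDeriv_le_of_forall_mem_sphere_norm_le k hS
      (hq.diffContOnCl (s := Metric.ball 0 S)) (C := m)
      (fun z hz => hm z (by simpa using (mem_sphere_iff_norm.1 hz).le))
    rw [norm_mul, norm_inv, Complex.norm_natCast]
    have : (0 : ℝ) < k.factorial := by positivity
    calc _ ≤ (k.factorial : ℝ)⁻¹ * (k.factorial * m / S ^ k) := by gcongr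
      _ = _ := by field_simp

theorem norm_sum_mul_le_of_norm_le {s : Finset ℕ} {u v : ℕ → ℂ} {m : ℝ}
    (hu : ∀ i ∈ s, ‖u i‖ ≤ m) : ‖∑ i ∈ s, u i * v i‖ ≤ m * ∑ i ∈ s, ‖v i‖ := by
  rw [Finset.mul_sum]
  refine norm_sum_le_of_le _ fun i hi => ?_
  rw [norm_mul]
  exact mul_le_mul_of_nonneg_right (hu i hi) (norm_nonneg _)

/-- Geometric convergence of Lagrange interpolation of an entire function at well spaced nodes. -/
theorem WellSpaced.norm_interpolation_sub_le {N : ℕ} {x : ℕ → ℝ} (hx : WellSpaced N x)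
    {q : ℂ → ℂ} (hq : Differentiable ℂ q) {R S m : ℝ} (hR : 1 ≤ R) (hS : 2 * R ≤ S)
    (hm : ∀ w, ‖w‖ ≤ S → ‖q w‖ ≤ m) {w : ℂ} (hw : ‖w‖ ≤ R) :
    ‖∑ i ∈ Finset.range (N + 1), q (x i) * lagrangeBasis N x i w - q w‖ ≤
      4 * m * (12 * (R + 1) * R / S) ^ N := by
  have hm0 : 0 ≤ m := (norm_nonneg _).trans (hm 0 (by simp; linarith))
  obtain ⟨c, hc, hcS⟩ := hq.exists_coeff_hasSum
  have hS0 : 0 < S := by linarith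
  replace hcS := hcS S m hS0 hm
  set t : Polynomial ℂ := ∑ k ∈ Finset.range (N + 1), Polynomial.C (c k) * Polynomial.X ^ k
    with ht
  have hdeg : t.degree < (Finset.range (N + 1)).card := by
    rw [ht, Finset.card_range]
    refine (Polynomial.degree_sum_le _ _).trans_lt ?_
    rw [Finset.sup_lt_iff (by exact_mod_cast WithBot.bot_lt_coe _)]
    intro k hk
    refine (Polynomial.degree_C_mul_X_pow_le _ _).trans_lt ?_
    exact_mod_cast Finset.mem_range.1 hk
  have heval : ∀ w, t.eval w = ∑ i ∈ Finset.range (N + 1), t.eval (x i : ℂ) *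
      lagrangeBasis N x i w := by
    intro w
    conv_lhs => rw [Lagrange.eq_interpolate hx.injOn hdeg]
    simp [Lagrange.interpolate_apply, Polynomial.eval_finsetSum, lagrangeBasis]
  have hratio : R / S ≤ 1 / 2 := by
    rw [div_le_div_iff₀ hS0 (by norm_num)]; linarith
  have hrem : ∀ w : ℂ, ‖w‖ ≤ R → ‖q w - t.eval w‖ ≤ m * (R / S) ^ N := by
    intro w hw
    have h1 := (hasSum_nat_add_iff' (N + 1)).2 (hc w)
    have h2 : t.eval w = ∑ k ∈ Finset.range (N + 1), c k * w ^ k := by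
      simp [ht, Polynomial.eval_finsetSum]
    rw [h2]
    have h3 : HasSum (fun k : ℕ => m * (R / S) ^ N * (1 / 2 * (1 / 2) ^ k))
        (m * (R / S) ^ N * (1 / 2 * 2)) :=
      (hasSum_geometric_two.mul_left (1 / 2)).mul_left _
    norm_num only [mul_one] at h3
    rw [← h1.tsum_eq]
    refine tsum_of_norm_bounded h3 fun k => ?_
    rw [norm_mul, norm_pow]
    calc ‖c (k + (N + 1))‖ * ‖w‖ ^ (k + (N + 1))
        ≤ m / S ^ (k + (N + 1)) * R ^ (k + (N + 1)) := by
          gcongr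
          exact hcS _
      _ = m * (R / S) ^ N * ((R / S) * (R / S) ^ k) := by
          rw [div_pow, div_pow, pow_add, pow_add, pow_succ]
          have := hS0.ne'
          field_simp
          ring
      _ ≤ m * (R / S) ^ N * (1 / 2 * (1 / 2) ^ k) := by gcongr
      _ = _ := by norm_num
  have hsplit : ∑ i ∈ Finset.range (N + 1), q (x i) * lagrangeBasis N x i w - q w =
      ∑ i ∈ Finset.range (N + 1), (q (x i) - t.eval (x i : ℂ)) * lagrangeBasis N x i w -
        (q w - t.eval w) := by
    simp only [sub_mul, Finset.sum_sub_distrib]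
    rw [← heval]; ring
  rw [hsplit]
  have h4 : ∀ i ∈ Finset.range (N + 1), ‖q (x i) - t.eval (x i : ℂ)‖ ≤ m * (R / S) ^ N := by
    intro i hi
    have hi' : i ≤ N := by simpa [Nat.lt_succ_iff] using hi
    refine hrem _ ?_
    rw [Complex.norm_real, Real.norm_eq_abs, abs_of_nonneg (hx.1 i hi').1]
    exact (hx.1 i hi').2.trans hR
  have h5 := hx.sum_norm_lagrangeBasis_le hw
  have hK : (1 : ℝ) ≤ (12 * (R + 1)) ^ N := one_le_pow₀ (by linarith)
  calc _ ≤ m * (R / S) ^ N * (3 * (12 * (R + 1)) ^ N) + m * (R / S) ^ N * 1 :=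
        (norm_sub_le _ _).trans (add_le_add ((norm_sum_mul_le_of_norm_le h4).trans (by gcongr))
          ((hrem w hw).trans_eq (mul_one _).symm))
    _ ≤ m * (R / S) ^ N * (3 * (12 * (R + 1)) ^ N) +
        m * (R / S) ^ N * (12 * (R + 1)) ^ N := by gcongr
    _ = _ := by rw [mul_div_assoc, mul_pow (12 * (R + 1))]; ring

/-- A version of the three spheres theorem: geometric interpolation of bounds on concentric
balls. -/
theorem norm_le_two_mul_sqrt_of_norm_le {E : Type*} [NormedAddCommGroup E] [NormedSpace ℂ E]
    {Q : E → ℂ} (hQ : Differentiable ℂ Q) {a : E} {r T ρ M₁ M₂ : ℝ} (hr : 0 < r) (hρ : 0 < ρ)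
    (hT : 4 * ρ ^ 2 ≤ r * T) (h₁ : ∀ z, ‖z - a‖ ≤ T → ‖Q z‖ ≤ M₁)
    (h₂ : ∀ z, ‖z - a‖ ≤ r → ‖Q z‖ ≤ M₂) {z : E} (hz : ‖z - a‖ ≤ ρ) :
    ‖Q z‖ ≤ 2 * √(M₁ * M₂) := by
  have hT0 : 0 < T := by
    by_contra! hcon
    nlinarith [mul_nonneg hr.le (neg_nonneg.2 hcon), sq_pos_of_pos hρ]
  set u : E := (ρ⁻¹ : ℂ) • (z - a) with hu
  have hu1 : ‖u‖ ≤ 1 := by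
    rw [hu, norm_smul, norm_inv, Complex.norm_real, Real.norm_eq_abs, abs_of_pos hρ,
      inv_mul_le_iff₀ hρ]
    simpa using hz
  have hline : Differentiable ℂ fun ζ : ℂ => Q (a + ζ • u) := by fun_prop
  have hnorm : ∀ (ζ : ℂ) (s : ℝ), ‖ζ‖ ≤ s → ‖a + ζ • u - a‖ ≤ s := by
    intro ζ s hζ
    rw [add_sub_cancel_left, norm_smul]
    nlinarith [norm_nonneg ζ, norm_nonneg u]
  obtain ⟨c, hc, hb⟩ := hline.exists_coeff_hasSum
  have hb1 := hb T M₁ hT0 fun ζ hζ => h₁ _ (hnorm ζ T hζ)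
  have hb2 := hb r M₂ hr fun ζ hζ => h₂ _ (hnorm ζ r hζ)
  have hM₁ : 0 ≤ M₁ := (norm_nonneg _).trans (h₁ a (by simpa using hT0.le))
  have hM₂ : 0 ≤ M₂ := (norm_nonneg _).trans (h₂ a (by simpa using hr.le))
  have hz' : a + (ρ : ℂ) • u = z := by
    have : (ρ : ℂ) ≠ 0 := by exact_mod_cast hρ.ne'
    rw [hu, smul_smul, mul_inv_cancel₀ this, one_smul, add_sub_cancel]
  have hsum := hc ρ
  rw [hz'] at hsum
  rw [← hsum.tsum_eq, mul_comm]
  refine tsum_of_norm_bounded (hasSum_geometric_two.mul_left _) fun k => ?_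
  rw [norm_mul, norm_pow, Complex.norm_real, Real.norm_eq_abs, abs_of_pos hρ]
  refine abs_le_of_sq_le_sq' ?_ (by positivity) |>.2
  rw [mul_pow (√_), Real.sq_sqrt (by positivity)]
  calc (‖c k‖ * ρ ^ k) ^ 2 = ‖c k‖ * ‖c k‖ * (ρ ^ 2) ^ k := by ring
    _ ≤ M₁ / T ^ k * (M₂ / r ^ k) * (r * T / 4) ^ k := by
        gcongr
        · exact hb1 k
        · exact hb2 k
        · linarith
    _ = _ := by
        rw [div_pow, mul_pow, ← pow_mul, mul_comm k 2, pow_mul]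
        field_simp
        rw [mul_assoc, ← mul_pow]; norm_num

section Entire

open Filter Topology Metric

variable {V : Type*} [NormedAddCommGroup V] [NormedSpace ℂ V]

/-- The identity theorem on balls of a complex normed space. -/
theorem DifferentiableOn.eqOn_ball_of_eventuallyEq {F G : V → ℂ} {c : V} {ρ : ℝ}
    (hF : DifferentiableOn ℂ F (ball c ρ)) (hG : DifferentiableOn ℂ G (ball c ρ))
    (h : F =ᶠ[𝓝 c] G) : Set.EqOn F G (ball c ρ) := by
  intro x hx
  rcases eq_or_ne x c with rfl | hxc
  · exact h.self_of_nhds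
  have hpos : 0 < ‖x - c‖ := norm_pos_iff.2 (sub_ne_zero.2 hxc)
  have hρ : ‖x - c‖ < ρ := mem_ball_iff_norm.1 hx
  set φ : ℂ → V := fun ζ => c + ζ • (x - c) with hφ
  have hφd : Differentiable ℂ φ := by fun_prop
  have hmaps : Set.MapsTo φ (ball 0 (ρ / ‖x - c‖)) (ball c ρ) := by
    intro ζ hζ
    rw [mem_ball_zero_iff, lt_div_iff₀ hpos] at hζ
    simpa [hφ, mem_ball_iff_norm, norm_smul] using hζ
  have hev : F ∘ φ =ᶠ[𝓝 0] G ∘ φ := by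
    have : Tendsto φ (𝓝 0) (𝓝 c) := by
      simpa [hφ] using hφd.continuous.tendsto 0
    exact this.eventually h
  have := AnalyticOnNhd.eqOn_of_preconnected_of_eventuallyEq
    ((hF.comp hφd.differentiableOn hmaps).analyticOnNhd isOpen_ball)
    ((hG.comp hφd.differentiableOn hmaps).analyticOnNhd isOpen_ball)
    (convex_ball (0 : ℂ) (ρ / ‖x - c‖)).isPreconnected
    (mem_ball_self (div_pos (hpos.trans hρ) hpos)) hev
    (show (1 : ℂ) ∈ ball (0 : ℂ) (ρ / ‖x - c‖) by
      rw [mem_ball_zero_iff, norm_one, lt_div_iff₀ hpos]; simpa using hρ)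
  simpa [hφ] using this

/-- The identity theorem for entire functions on a complex normed space. -/
theorem Differentiable.eq_of_eventuallyEq_nhds {F G : V → ℂ} {c : V} (hF : Differentiable ℂ F)
    (hG : Differentiable ℂ G) (h : F =ᶠ[𝓝 c] G) : F = G := by
  funext x
  have hx : x ∈ ball c (Dist.dist x c + 1) := mem_ball.2 (lt_add_one _)
  exact hF.differentiableOn.eqOn_ball_of_eventuallyEq hG.differentiableOn h hx

/-- Germs which extend holomorphically to arbitrarily large balls extend to entire functions. -/
theorem exists_differentiable_of_forall_ball {H : V → ℂ} {c : V}
    (h : ∀ n : ℕ, ∃ F : V → ℂ, DifferentiableOn ℂ F (ball c (n + 1)) ∧ F =ᶠ[𝓝 c] H) :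
    ∃ F : V → ℂ, Differentiable ℂ F ∧ F =ᶠ[𝓝 c] H := by
  choose Φ hΦd hΦ using h
  have hcompat : ∀ m n : ℕ, ∀ x ∈ ball c (m + 1), x ∈ ball c (n + 1) → Φ m x = Φ n x := by
    intro m n x hm hn
    wlog hmn : m ≤ n generalizing m n
    · exact (this n m hn hm (by omega)).symm
    have hmn' : (m : ℝ) ≤ n := by exact_mod_cast hmn
    exact (hΦd m).eqOn_ball_of_eventuallyEq ((hΦd n).mono (ball_subset_ball (by linarith)))
      ((hΦ m).trans (hΦ n).symm) hm
  have hceil : ∀ x, x ∈ ball c ((⌈dist x c⌉₊ : ℝ) + 1) := fun x =>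
    mem_ball.2 ((Nat.le_ceil _).trans_lt (lt_add_one _))
  have heq : ∀ n : ℕ, Set.EqOn (fun x => Φ ⌈dist x c⌉₊ x) (Φ n) (ball c (n + 1)) :=
    fun n x hx => hcompat _ _ x (hceil x) hx
  refine ⟨fun x => Φ ⌈dist x c⌉₊ x, fun x => ?_, ?_⟩
  · have hnhds := isOpen_ball.mem_nhds (hceil x)
    exact ((hΦd _).differentiableAt hnhds).congr_of_eventuallyEq
      (Filter.mem_of_superset hnhds (heq _))
  · have h0 : (fun x => Φ ⌈dist x c⌉₊ x) =ᶠ[𝓝 c] Φ 0 :=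
      Filter.mem_of_superset (ball_mem_nhds c (by positivity)) (heq 0)
    exact h0.trans (hΦ 0)

/-- The limit of a rapidly convergent sequence of entire functions is holomorphic on a slightly
smaller ball. -/
theorem exists_differentiableOn_ball_of_summable {P : ℕ → V → ℂ} {H : V → ℂ} {c : V} {ρ : ℝ}
    {u : ℕ → ℝ} (hρ : 0 < ρ) (hP : ∀ n, Differentiable ℂ (P n)) (hu : Summable u)
    (hPu : ∀ n, ∀ x ∈ ball c (ρ + 1), ‖P (n + 1) x - P n x‖ ≤ u n)
    (hH : ∀ᶠ x in 𝓝 c, Tendsto (fun n => P n x) atTop (𝓝 (H x))) :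
    ∃ F : V → ℂ, DifferentiableOn ℂ F (ball c ρ) ∧ F =ᶠ[𝓝 c] H := by
  have hQ : ∀ n, Differentiable ℂ fun x => P (n + 1) x - P n x := fun n => (hP _).sub (hP n)
  have hsum : ∀ x ∈ ball c (ρ + 1), Summable fun n => P (n + 1) x - P n x := fun x hx =>
    Summable.of_norm_bounded hu fun n => hPu n x hx
  have hsub : ball c ρ ⊆ ball c (ρ + 1) := ball_subset_ball (by linarith)
  refine ⟨fun x => P 0 x + ∑' n, (P (n + 1) x - P n x), ?_, ?_⟩
  · refine (hP 0).differentiableOn.add fun x hx => ?_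
    refine (hasFDerivAt_tsum_of_isPreconnected (hu.mul_left 2) isOpen_ball
      (isConnected_ball hρ).isPreconnected
      (fun n y _ => (hQ n y).hasFDerivAt) (fun n y hy => ?_) hx (hsum x (hsub hx))
      hx).differentiableAt.differentiableWithinAt
    have hy1 : ball y 1 ⊆ ball c (ρ + 1) := ball_subset_ball' (by
      have := mem_ball.1 hy
      linarith)
    have := Complex.norm_fderiv_le_div_of_mapsTo_ball (hQ n).differentiableOn (c := y)
      (R₁ := 1) (R₂ := 2 * u n) (fun z hz => ?_) one_pos
    · simpa using this
    · rw [mem_closedBall_iff_norm]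
      have h1 := hPu n z (hy1 hz)
      have h2 := hPu n y (hsub hy)
      exact (norm_sub_le _ _).trans (by linarith)
  · filter_upwards [hH, ball_mem_nhds c (show 0 < ρ + 1 by linarith)] with x hx hxb
    have h1 := (hsum x hxb).hasSum.tendsto_sum_nat
    simp only [Finset.sum_range_sub fun n => P n x] at h1
    have h2 := tendsto_nhds_unique h1 (hx.sub_const (P 0 x))
    rw [h2]
    ring

end Entire

section SegmentCross

open Filter Topology Metric

/-- Interpolation of a family of functions on `E` in an additional complex variable. -/
noncomputable def interpolant {E : Type*} (g : ℝ → E → ℂ) (N : ℕ) (x : ℕ → ℝ) (z : E) (w : ℂ) : ℂ :=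
  ∑ i ∈ Finset.range (N + 1), g (x i) z * lagrangeBasis N x i w

theorem norm_interpolant_le {E : Type*} {g : ℝ → E → ℂ} {N : ℕ} {x : ℕ → ℝ} (hx : WellSpaced N x)
    {z : E} {M R : ℝ} (hM : ∀ i ≤ N, ‖g (x i) z‖ ≤ M) {w : ℂ} (hw : ‖w‖ ≤ R) :
    ‖interpolant g N x z w‖ ≤ M * (3 * (12 * (R + 1)) ^ N) := by
  have hM0 : 0 ≤ M := (norm_nonneg _).trans (hM 0 (Nat.zero_le _))
  exact (norm_sum_mul_le_of_norm_le fun i hi => hM i (by simpa [Nat.lt_succ_iff] using hi)).trans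
    (mul_le_mul_of_nonneg_left (hx.sum_norm_lagrangeBasis_le hw) hM0)

theorem norm_interpolant_sub_le {E : Type*} {g : ℝ → E → ℂ} {N : ℕ} {x : ℕ → ℝ} (hx : WellSpaced N x)
    {z : E} {q : ℂ → ℂ} (hq : Differentiable ℂ q) (hgq : ∀ t ∈ Set.Icc (0 : ℝ) 1, g t z = q t)
    {R S m : ℝ} (hR : 1 ≤ R) (hS : 2 * R ≤ S) (hm : ∀ w, ‖w‖ ≤ S → ‖q w‖ ≤ m) {w : ℂ}
    (hw : ‖w‖ ≤ R) :
    ‖interpolant g N x z w - q w‖ ≤ 4 * m * (12 * (R + 1) * R / S) ^ N := by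
  convert! hx.norm_interpolation_sub_le hq hR hS hm hw using 3
  refine Finset.sum_congr rfl fun i hi => ?_
  rw [hgq _ (hx.1 i (by simpa [Nat.lt_succ_iff] using hi))]

theorem Differentiable.exists_forall_norm_le {q : ℂ → ℂ} (hq : Differentiable ℂ q) (S : ℝ) :
    ∃ m, ∀ w, ‖w‖ ≤ S → ‖q w‖ ≤ m := by
  obtain ⟨m, hm⟩ := (isCompact_closedBall (0 : ℂ) S).exists_bound_of_continuousOn
    hq.continuous.continuousOn
  exact ⟨m, fun w hw => hm w (by simpa using hw)⟩

theorem exists_geometric_interpolant_bound {E : Type*} {g : ℝ → E → ℂ} {x : ℕ → ℕ → ℝ}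
    (hx : ∀ N, WellSpaced N (x N)) {z : E} {q : ℂ → ℂ} (hq : Differentiable ℂ q)
    (hgq : ∀ t ∈ Set.Icc (0 : ℝ) 1, g t z = q t) (R : ℝ) :
    ∃ m, ∀ N w, ‖w‖ ≤ R → ‖interpolant g N (x N) z w - q w‖ ≤ m * (1 / 2) ^ N := by
  wlog hR : 1 ≤ R generalizing R
  · obtain ⟨m, hm⟩ := this 1 le_rfl
    exact ⟨m, fun N w hw => hm N w (by linarith)⟩
  obtain ⟨m, hm⟩ := hq.exists_forall_norm_le (2 * (12 * (R + 1) * R))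
  refine ⟨4 * m, fun N w hw => ?_⟩
  convert! norm_interpolant_sub_le (hx N) hq hgq hR (by nlinarith) hm hw using 3
  field_simp

variable {E : Type*} [NormedAddCommGroup E] [NormedSpace ℂ E]

theorem differentiable_interpolant {g : ℝ → E → ℂ} {N : ℕ} {x : ℕ → ℝ} (hx : WellSpaced N x)
    (hg : ∀ t ∈ Set.Icc (0 : ℝ) 1, Differentiable ℂ (g t)) :
    Differentiable ℂ fun p : E × ℂ => interpolant g N x p.1 p.2 := by
  unfold interpolant
  refine Differentiable.fun_sum fun i hi => ?_
  exact ((hg _ (hx.1 i (by simpa [Nat.lt_succ_iff] using hi))).comp differentiable_fst).mul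
    ((differentiable_lagrangeBasis N x i).comp differentiable_snd)

/-- By Baire's theorem the entire functions `h z` are locally bounded in `z`, uniformly on every
disc, near a suitable point `a`. -/
theorem exists_locally_bounded [CompleteSpace E] {A : Set E} (hA : IsOpen A) (hAne : A.Nonempty)
    {g : ℝ → E → ℂ} (hg : ∀ t ∈ Set.Icc (0 : ℝ) 1, Differentiable ℂ (g t))
    {h : E → ℂ → ℂ} (hh : ∀ z ∈ A, Differentiable ℂ (h z))
    (hgh : ∀ z ∈ A, ∀ t ∈ Set.Icc (0 : ℝ) 1, g t z = h z t) :
    ∃ a ∈ A, ∀ S : ℝ, ∃ r > 0, ∃ m, ∀ z, ‖z - a‖ ≤ r → z ∈ A ∧ ∀ w, ‖w‖ ≤ S → ‖h z w‖ ≤ m := by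
  set x : ℕ → ℕ → ℝ := fun N i => (i : ℝ) / (N + 1) with hxdef
  have hx : ∀ N, WellSpaced N (x N) := wellSpaced_equidistant
  set C : ℕ → Option ℕ → Set E := fun S m => m.elim Aᶜ fun m =>
    {z | ∀ N w, ‖w‖ ≤ S → ‖interpolant g N (x N) z w‖ ≤ m} with hC
  have hCclosed : ∀ S m, IsClosed (C S m) := by
    rintro S (_ | m)
    · exact hA.isClosed_compl
    · simp only [hC, Option.elim, Set.ofPred_forall]
      refine isClosed_iInter fun N => isClosed_iInter fun w => isClosed_iInter fun _ => ?_
      have : Continuous fun z : E => interpolant g N (x N) z w :=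
        (differentiable_interpolant (hx N) hg).continuous.comp
          (by fun_prop : Continuous fun z : E => (z, w))
      exact isClosed_le this.norm continuous_const
  have hCunion : ∀ S, ⋃ m, C S m = Set.univ := by
    intro S
    refine Set.eq_univ_of_forall fun z => Set.mem_iUnion.2 ?_
    by_cases hz : z ∈ A
    · obtain ⟨m₁, hm₁⟩ := exists_geometric_interpolant_bound hx (hh z hz) (hgh z hz) S
      obtain ⟨m₂, hm₂⟩ := (hh z hz).exists_forall_norm_le S
      obtain ⟨m, hm⟩ := exists_nat_ge (|m₁| + m₂)
      refine ⟨some m, fun N w hw => le_trans ?_ hm⟩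
      have h1 : m₁ * (1 / 2) ^ N ≤ |m₁| * 1 := by
        gcongr
        · exact le_abs_self _
        · exact pow_le_one₀ (by norm_num) (by norm_num)
      have h2 := norm_le_norm_sub_add (interpolant g N (x N) z w) (h z w)
      linarith [hm₁ N w hw, hm₂ w hw]
    · exact ⟨none, hz⟩
  have hdense : Dense (⋂ S : ℕ, ⋃ m, interior (C S m)) :=
    dense_iInter_of_isOpen (fun S => isOpen_iUnion fun m => isOpen_interior)
      fun S => dense_iUnion_interior_of_closed (hCclosed S) (hCunion S)
  obtain ⟨a, haA, ha⟩ := hdense.inter_open_nonempty A hA hAne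
  refine ⟨a, haA, fun S => ?_⟩
  obtain ⟨n, hn⟩ := exists_nat_ge S
  obtain ⟨m, hm⟩ := Set.mem_iUnion.1 (Set.mem_iInter.1 ha n)
  rcases m with _ | m
  · exact absurd haA (interior_subset hm)
  obtain ⟨r, hr, hball⟩ := nhds_basis_closedBall.mem_iff.1
    (Filter.inter_mem (hA.mem_nhds haA) (isOpen_interior.mem_nhds hm))
  refine ⟨r, hr, m, fun z hz => ?_⟩
  obtain ⟨hzA, hzC⟩ := hball (mem_closedBall_iff_norm.2 hz)
  refine ⟨hzA, fun w hw => ?_⟩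
  have hw' : ‖w‖ ≤ n := hw.trans hn
  obtain ⟨m₁, hm₁⟩ := exists_geometric_interpolant_bound hx (hh z hzA) (hgh z hzA) n
  have hlim : Tendsto (fun N => interpolant g N (x N) z w) atTop (𝓝 (h z w)) := by
    rw [tendsto_iff_norm_sub_tendsto_zero]
    refine squeeze_zero (fun _ => norm_nonneg _) (fun N => hm₁ N w hw') ?_
    simpa using (tendsto_pow_atTop_nhds_zero_of_lt_one (by norm_num : (0 : ℝ) ≤ 1 / 2)
      (by norm_num)).const_mul m₁
  exact le_of_tendsto hlim.norm (Eventually.of_forall fun N => interior_subset hzC N w hw')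

/-- Well spaced nodes at which an exhausting sequence of conditions holds. -/
theorem exists_wellSpaced_of_iUnion {s : ℕ → Set ℝ} (hs : Monotone s)
    (hs' : Set.Icc (0 : ℝ) 1 ⊆ ⋃ M, s M) :
    ∃ M, ∀ N, ∃ x, WellSpaced N x ∧ ∀ i ≤ N, x i ∈ s M := by
  have hmono : Monotone fun M => s M ∩ Set.Icc (0 : ℝ) 1 := fun i j hij =>
    Set.inter_subset_inter_left _ (hs hij)
  have h1 : (1 : ENNReal) = ⨆ M, MeasureTheory.volume (s M ∩ Set.Icc (0 : ℝ) 1) := by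
    rw [← hmono.measure_iUnion, ← Set.iUnion_inter, Set.inter_eq_right.2 hs']
    simp
  have h2 : ENNReal.ofReal (1 / 2) < ⨆ M, MeasureTheory.volume (s M ∩ Set.Icc (0 : ℝ) 1) := by
    rw [← h1, ← ENNReal.ofReal_one]
    exact (ENNReal.ofReal_lt_ofReal_iff one_pos).2 (by norm_num)
  obtain ⟨M, hM⟩ := lt_iSup_iff.1 h2
  refine ⟨M, fun N => ?_⟩
  obtain ⟨x, hx, hx'⟩ := exists_separated_of_lt_volume (2 * ((N : ℝ) + 1))⁻¹ (by positivity) N _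
    (bddBelow_Icc.mono Set.inter_subset_right) (lt_of_le_of_lt (ENNReal.ofReal_le_ofReal (by
      rw [← div_eq_mul_inv, div_le_div_iff₀ (by positivity) (by norm_num)]; linarith)) hM)
  exact ⟨x, ⟨fun i hi => (hx i hi).2, hx'⟩, fun i hi => (hx i hi).1⟩

/-- A cross formed by an open set `A` of a finite-dimensional space and a real segment in the
plane: a function which is entire along both families of fibres extends to an entire function. -/
theorem exists_entire_extension_segment [FiniteDimensional ℂ E] {A : Set E} (hA : IsOpen A)
    (hAne : A.Nonempty) {g : ℝ → E → ℂ} (hg : ∀ t ∈ Set.Icc (0 : ℝ) 1, Differentiable ℂ (g t))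
    {h : E → ℂ → ℂ} (hh : ∀ z ∈ A, Differentiable ℂ (h z))
    (hgh : ∀ z ∈ A, ∀ t ∈ Set.Icc (0 : ℝ) 1, g t z = h z t) :
    ∃ F : E × ℂ → ℂ, Differentiable ℂ F ∧ ∀ z ∈ A, ∀ w, F (z, w) = h z w := by
  have := FiniteDimensional.complete ℂ E
  have := FiniteDimensional.proper ℂ E
  obtain ⟨a, haA, ha⟩ := exists_locally_bounded hA hAne hg hh hgh
  obtain ⟨F, hF, hFh⟩ : ∃ F : E × ℂ → ℂ, Differentiable ℂ F ∧
      F =ᶠ[𝓝 (a, 0)] fun p => h p.1 p.2 := by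
    refine exists_differentiable_of_forall_ball fun n => ?_
    set R : ℝ := n + 1 + 1 with hRdef
    have hR : 1 ≤ R := by rw [hRdef]; linarith [(Nat.cast_nonneg n : (0 : ℝ) ≤ n)]
    set K : ℝ := 12 * (R + 1) with hK
    have hK1 : 1 ≤ K := by linarith
    obtain ⟨r, hr, m, hm⟩ := ha (4 * K ^ 2 * R)
    set T : ℝ := 4 * R ^ 2 / r with hT
    obtain ⟨M, hM⟩ := exists_wellSpaced_of_iUnion
      (s := fun M : ℕ => {t | ∀ z, ‖z - a‖ ≤ T → ‖g t z‖ ≤ M})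
      (fun i j hij t ht z hz => (ht z hz).trans (by exact_mod_cast hij)) (fun t ht => by
        obtain ⟨b, hb⟩ := (isCompact_closedBall a T).exists_bound_of_continuousOn
          (hg t ht).continuous.continuousOn
        obtain ⟨M, hM⟩ := exists_nat_ge b
        exact Set.mem_iUnion.2 ⟨M, fun z hz => (hb z (mem_closedBall_iff_norm.2 hz)).trans hM⟩)
    choose x hx hxM using hM
    have hm0 : 0 ≤ m := (norm_nonneg _).trans
      ((hm a (by simpa using hr.le)).2 0 (by simp; positivity))
    have hratio : K * R / (4 * K ^ 2 * R) = 1 / (4 * K) := by field_simp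
    have hnear : ∀ N z, ‖z - a‖ ≤ r → ∀ w, ‖w‖ ≤ R →
        ‖interpolant g N (x N) z w - h z w‖ ≤ 4 * m * (1 / (4 * K)) ^ N := by
      intro N z hz w hw
      obtain ⟨hzA, hzm⟩ := hm z hz
      rw [← hratio]
      exact norm_interpolant_sub_le (hx N) (hh z hzA) (hgh z hzA) hR (by nlinarith) hzm hw
    have hq0 : 0 ≤ 1 / (4 * K) := by positivity
    have hq1 : 1 / (4 * K) < 1 := by rw [div_lt_one (by positivity)]; linarith
    refine exists_differentiableOn_ball_of_summable
      (P := fun N p => interpolant g N (x N) p.1 p.2)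
      (u := fun N => 2 * √(48 * M * K * m) * (1 / 2) ^ N) (by positivity)
      (fun N => differentiable_interpolant (hx N) hg)
      (summable_geometric_two.mul_left _) ?_ ?_
    · rintro N ⟨z, w⟩ hp
      rw [← hRdef, mem_ball_iff_norm, Prod.norm_def, max_lt_iff] at hp
      simp only [Prod.mk_sub_mk, sub_zero] at hp
      obtain ⟨hz, hw⟩ := hp
      have hdiff : ∀ N, Differentiable ℂ fun z => interpolant g N (x N) z w := fun N =>
        (differentiable_interpolant (hx N) hg).comp
          (by fun_prop : Differentiable ℂ fun z : E => (z, w))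
      have hfar : ∀ N z, ‖z - a‖ ≤ T → ‖interpolant g N (x N) z w‖ ≤ M * (3 * K ^ N) :=
        fun N z hz => norm_interpolant_le (hx N) (fun i hi => hxM N i hi z hz) hw.le
      have key := norm_le_two_mul_sqrt_of_norm_le ((hdiff (N + 1)).sub (hdiff N))
        (a := a) (T := T) (ρ := R) (M₁ := 6 * M * K ^ (N + 1))
        (M₂ := 8 * m * (1 / (4 * K)) ^ N) hr (by linarith)
        (by rw [hT, mul_div_cancel₀ _ hr.ne']) (fun z hz => ?_) (fun z hz => ?_) hz.le
      · refine key.trans_eq ?_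
        rw [mul_assoc 2]
        congr 1
        rw [← Real.sqrt_sq (show (0 : ℝ) ≤ (1 / 2) ^ N by positivity),
          ← Real.sqrt_mul (by positivity)]
        congr 1
        have e1 : K ^ (N + 1) * (1 / (4 * K)) ^ N = K * ((1 / 2) ^ N) ^ 2 := by
          have e0 : K * (1 / (4 * K)) = (1 / 2) ^ 2 := by field_simp; norm_num
          calc K ^ (N + 1) * (1 / (4 * K)) ^ N = K * (K * (1 / (4 * K))) ^ N := by
                rw [mul_pow K (1 / (4 * K)) N, pow_succ', mul_assoc]
            _ = K * ((1 / 2) ^ N) ^ 2 := by rw [e0, ← pow_mul, ← pow_mul, mul_comm 2]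
        linear_combination 48 * M * m * e1
      · have h1 := hfar (N + 1) z hz
        have h2 := hfar N z hz
        have h3 : K ^ N ≤ K ^ (N + 1) := pow_le_pow_right₀ hK1 (Nat.le_succ N)
        have h4 : (M : ℝ) * (3 * K ^ N) ≤ M * (3 * K ^ (N + 1)) := by gcongr
        exact (norm_sub_le _ _).trans (by linarith)
      · have h1 := hnear (N + 1) z hz w hw.le
        have h2 := hnear N z hz w hw.le
        have h3 : (1 / (4 * K)) ^ (N + 1) ≤ (1 / (4 * K)) ^ N :=
          pow_le_pow_of_le_one hq0 hq1.le (Nat.le_succ N)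
        have h4 : 4 * m * (1 / (4 * K)) ^ (N + 1) ≤ 4 * m * (1 / (4 * K)) ^ N := by gcongr
        have h5 := norm_sub_le_norm_sub_add_norm_sub (interpolant g (N + 1) (x (N + 1)) z w)
          (h z w) (interpolant g N (x N) z w)
        rw [norm_sub_rev (h z w)] at h5
        exact h5.trans (by linarith)
    · filter_upwards [ball_mem_nhds ((a, 0) : E × ℂ) (lt_min hr (by linarith : 0 < R))]
      rintro ⟨z, w⟩ hp
      rw [mem_ball_iff_norm, Prod.norm_def, max_lt_iff] at hp
      simp only [Prod.mk_sub_mk, sub_zero, lt_min_iff] at hp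
      rw [tendsto_iff_norm_sub_tendsto_zero]
      refine squeeze_zero (fun _ => norm_nonneg _)
        (fun N => hnear N z hp.1.1.le w hp.2.2.le) ?_
      simpa using (tendsto_pow_atTop_nhds_zero_of_lt_one hq0 hq1).const_mul (4 * m)
  obtain ⟨δ, hδ, hball⟩ := Metric.eventually_nhds_iff_ball.1
    (hFh.and (prod_mem_nhds (hA.mem_nhds haA) (univ_mem : (Set.univ : Set ℂ) ∈ 𝓝 0)))
  have hseg : ∀ t ∈ Set.Icc (0 : ℝ) 1, t < δ → ∀ z, F (z, t) = g t z := by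
    intro t ht htδ
    refine fun z => congrFun (Differentiable.eq_of_eventuallyEq_nhds (c := a)
      (hF.comp (by fun_prop : Differentiable ℂ fun z : E => (z, (t : ℂ)))) (hg t ht) ?_) z
    filter_upwards [ball_mem_nhds a hδ] with z hz
    have hmem : (z, (t : ℂ)) ∈ ball ((a, 0) : E × ℂ) δ := by
      rw [← ball_prod_same]
      exact ⟨hz, by simpa [abs_of_nonneg ht.1] using htδ⟩
    obtain ⟨h1, h2⟩ := hball _ hmem
    exact h1.trans (hgh z h2.1 t ht).symm
  refine ⟨F, hF, fun z hz => ?_⟩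
  have hFz : Differentiable ℂ fun w => F (z, w) :=
    hF.comp (by fun_prop : Differentiable ℂ fun w : ℂ => (z, w))
  refine congrFun (AnalyticOnNhd.eq_of_frequently_eq (z₀ := 0)
    (fun w _ => hFz.analyticAt w) (fun w _ => (hh z hz).analyticAt w) ?_)
  have hlim : Tendsto (fun t : ℝ => (t : ℂ)) (𝓝[>] 0) (𝓝[≠] 0) := by
    refine tendsto_nhdsWithin_iff.2 ⟨?_, ?_⟩
    · exact (Complex.continuous_ofReal.tendsto' 0 0 (by simp)).mono_left nhdsWithin_le_nhds
    · filter_upwards [self_mem_nhdsWithin] with t ht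
      simpa using (Set.mem_Ioi.1 ht).ne'
  refine hlim.frequently (Eventually.frequently ?_)
  filter_upwards [Ioo_mem_nhdsGT (lt_min one_pos hδ)] with t ht
  obtain ⟨ht1, ht2⟩ := lt_min_iff.1 ht.2
  have ht' : t ∈ Set.Icc (0 : ℝ) 1 := ⟨ht.1.le, ht1.le⟩
  rw [hseg t ht' ht2, hgh z hz t ht']

end SegmentCross

section Cross

open Filter Topology Metric

/-- A function on a product of plane open sets with entire slices extends to an entire function. -/
theorem exists_entire_extension_fin_s2 {d : ℕ} {A : Fin d → Set ℂ} (hAo : ∀ i, IsOpen (A i))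
    (hAne : ∀ i, (A i).Nonempty) {f : (Fin d → ℂ) → ℂ}
    (hf : ∀ a ∈ Set.univ.pi A, ∀ i, Differentiable ℂ fun w => f (Function.update a i w)) :
    ∃ F : (Fin d → ℂ) → ℂ, Differentiable ℂ F ∧ Set.EqOn F f (Set.univ.pi A) := by
  induction d with
  | zero =>
    refine ⟨fun _ => f 0, differentiable_const _, fun v _ => ?_⟩
    rw [Subsingleton.elim v 0]
  | succ d ih =>
    have hcons : ∀ w ∈ A 0, ∀ z ∈ Set.univ.pi fun i => A i.succ,
        (Fin.cons w z : Fin (d + 1) → ℂ) ∈ Set.univ.pi A := by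
      intro w hw z hz i _
      refine Fin.cases ?_ (fun i => ?_) i
      · simpa using hw
      · simpa using hz i trivial
    have hG : ∀ w, ∃ G : (Fin d → ℂ) → ℂ, w ∈ A 0 → Differentiable ℂ G ∧
        Set.EqOn G (fun z => f (Fin.cons w z)) (Set.univ.pi fun i => A i.succ) := by
      intro w
      by_cases hw : w ∈ A 0
      · obtain ⟨G, hG⟩ := ih (fun i => hAo i.succ) (fun i => hAne i.succ)
          (f := fun z => f (Fin.cons w z)) fun z hz i => by
            simpa only [Fin.cons_update] using hf _ (hcons w hw z hz) i.succ
        exact ⟨G, fun _ => hG⟩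
      · exact ⟨0, fun h => absurd h hw⟩
    choose G hG using hG
    obtain ⟨b, hb⟩ := hAne 0
    obtain ⟨ε, hε, hball⟩ := Metric.isOpen_iff.1 (hAo 0) b hb
    have hmem : ∀ t ∈ Set.Icc (0 : ℝ) 1, b + (ε / 2 : ℝ) * (t : ℂ) ∈ A 0 := by
      intro t ht
      refine hball ?_
      rw [mem_ball_iff_norm, add_sub_cancel_left, ← Complex.ofReal_mul, Complex.norm_real,
        Real.norm_of_nonneg (mul_nonneg (by positivity) ht.1)]
      nlinarith [ht.2]
    have hε' : ((ε / 2 : ℝ) : ℂ) ≠ 0 := by exact_mod_cast (by positivity : ε / 2 ≠ 0)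
    obtain ⟨F, hF, hFf⟩ := exists_entire_extension_segment
      (A := Set.univ.pi fun i : Fin d => A i.succ)
      (isOpen_set_pi Set.finite_univ fun i _ => hAo i.succ)
      (Set.univ_pi_nonempty_iff.2 fun i => hAne i.succ)
      (g := fun t => G (b + (ε / 2 : ℝ) * (t : ℂ))) (fun t ht => (hG _ (hmem t ht)).1)
      (h := fun z w => f (Fin.cons (b + (ε / 2 : ℝ) * w) z)) (fun z hz => by
        have h0 := hf _ (hcons b hb z hz) 0
        simp only [Fin.update_cons_zero] at h0
        exact h0.comp (by fun_prop : Differentiable ℂ fun w : ℂ => b + (ε / 2 : ℝ) * w))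
      (fun z hz t ht => (hG _ (hmem t ht)).2 hz)
    refine ⟨fun v => F (fun i => v i.succ, (v 0 - b) / (ε / 2 : ℝ)), hF.comp ?_, fun v hv => ?_⟩
    · fun_prop
    · have h1 := hFf (fun i => v i.succ) (fun i _ => hv i.succ trivial) ((v 0 - b) / (ε / 2 : ℝ))
      rw [mul_div_cancel₀ _ hε', add_sub_cancel] at h1
      exact h1.trans (congrArg f (Fin.cons_self_tail v))

variable {ι : Type*} [DecidableEq ι]

theorem Function.update_mem_univ_pi {α : ι → Type*} {A : ∀ j, Set (α j)} {a : ∀ j, α j}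
    (ha : a ∈ Set.univ.pi A) {j : ι} {z : α j} (hz : z ∈ A j) :
    Function.update a j z ∈ Set.univ.pi A := by
  intro i _
  rcases eq_or_ne i j with rfl | hij
  · simpa using hz
  · simpa [hij] using ha i trivial

theorem differentiable_function_update {V : ι → Type*} [∀ j, NormedAddCommGroup (V j)]
    [∀ j, NormedSpace ℂ (V j)] (a : ∀ j, V j) (j : ι) :
    Differentiable ℂ fun z : V j => Function.update a j z :=
  fun z => (hasFDerivAt_update a z).differentiableAt

variable [Fintype ι]

/-- Near a given point, a function on a product of coordinate spaces whose slices along the factors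
are entire coincides with an entire function. -/
theorem exists_entire_eventuallyEq {κ : ι → Type*} [∀ j, Fintype (κ j)]
    {A : ∀ j, Set (κ j → ℂ)} (hAo : ∀ j, IsOpen (A j)) {f : (∀ j, κ j → ℂ) → ℂ}
    (hf : ∀ a ∈ Set.univ.pi A, ∀ j, Differentiable ℂ fun z => f (Function.update a j z))
    {c : ∀ j, κ j → ℂ} (hc : c ∈ Set.univ.pi A) :
    ∃ F : (∀ j, κ j → ℂ) → ℂ, Differentiable ℂ F ∧ F =ᶠ[𝓝 c] f := by
  classical
  obtain ⟨r, hr, hball⟩ := Metric.isOpen_iff.1 (isOpen_set_pi Set.finite_univ fun j _ => hAo j) c hc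
  have hmem : ∀ z : ∀ j, κ j → ℂ, z ∈ ball c r ↔ ∀ j i, z j i ∈ ball (c j i) r := by
    intro z
    simp only [mem_ball, dist_pi_lt_iff hr]
  let e := Fintype.equivFin (Σ j, κ j)
  have he : ∀ (z : ∀ j, κ j → ℂ) j i, z (e.symm (e ⟨j, i⟩)).1 (e.symm (e ⟨j, i⟩)).2 = z j i := by
    intro z j i
    rw [e.symm_apply_apply]
  obtain ⟨F, hF, hFf⟩ := exists_entire_extension_fin_s2
    (A := fun i => ball (c (e.symm i).1 (e.symm i).2) r) (fun i => isOpen_ball)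
    (fun i => nonempty_ball.2 hr) (f := fun v => f fun j i => v (e ⟨j, i⟩)) fun v hv m => by
      obtain ⟨⟨j, i⟩, rfl⟩ := e.surjective m
      set a : ∀ j, κ j → ℂ := fun j i => v (e ⟨j, i⟩) with ha_def
      have ha : a ∈ Set.univ.pi A := by
        refine hball ((hmem a).2 fun j i => ?_)
        simpa only [he] using hv (e ⟨j, i⟩) trivial
      have h1 : ∀ w, (fun j' i' => Function.update v (e ⟨j, i⟩) w (e ⟨j', i'⟩)) =
          Function.update a j (Function.update (a j) i w) := by
        intro w
        funext j' i'
        by_cases hj : j' = j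
        · subst hj
          by_cases hi : i' = i
          · subst hi
            simp
          · simp [hi, ha_def]
        · simp [hj, ha_def]
      simp only [h1]
      exact (hf a ha j).comp (differentiable_function_update (a j) i)
  refine ⟨fun z => F fun m => z (e.symm m).1 (e.symm m).2, hF.comp ?_, ?_⟩
  · refine differentiable_pi.2 fun m => ?_
    exact differentiable_pi.1 (differentiable_pi.1 differentiable_id (e.symm m).1) (e.symm m).2
  · filter_upwards [ball_mem_nhds c hr] with z hz
    exact (hFf fun m _ => (hmem z).1 hz _ _).trans
      (congrArg f (funext fun j => funext fun i => he z j i))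

/-- Functions with entire slices along all factors over a product of open sets have the identity
property. -/
theorem eqOn_univ_pi_of_eventuallyEq {V : ι → Type*} [∀ j, NormedAddCommGroup (V j)]
    [∀ j, NormedSpace ℂ (V j)] {A : ∀ j, Set (V j)} {f g : (∀ j, V j) → ℂ}
    (hAo : ∀ j, IsOpen (A j))
    (hf : ∀ a ∈ Set.univ.pi A, ∀ j, Differentiable ℂ fun z => f (Function.update a j z))
    (hg : ∀ a ∈ Set.univ.pi A, ∀ j, Differentiable ℂ fun z => g (Function.update a j z))
    {c : ∀ j, V j} (hc : c ∈ Set.univ.pi A) (hfg : f =ᶠ[𝓝 c] g) :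
    Set.EqOn f g (Set.univ.pi A) := by
  obtain ⟨r, hr, hball⟩ := Metric.eventually_nhds_iff_ball.1 hfg
  suffices h : ∀ T : Finset ι, ∀ a ∈ Set.univ.pi A, (∀ j ∉ T, a j ∈ ball (c j) r) → f a = g a from
    fun a ha => h Finset.univ a ha fun j hj => absurd (Finset.mem_univ j) hj
  intro T
  induction T using Finset.induction_on with
  | empty => exact fun a _ h => hball a ((dist_pi_lt_iff hr).2 fun j => h j (Finset.notMem_empty j))
  | insert j T hj ih =>
    intro a ha haT
    have h1 := congrFun (Differentiable.eq_of_eventuallyEq_nhds (c := c j) (hf a ha j) (hg a ha j) (by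
      filter_upwards [ball_mem_nhds (c j) hr, (hAo j).mem_nhds (hc j trivial)] with z hz hzA
      refine ih _ (Function.update_mem_univ_pi ha hzA) fun i hi => ?_
      rcases eq_or_ne i j with rfl | hij
      · simpa using hz
      · rw [Function.update_of_ne hij]
        exact haT i (by simp [hij, hi]))) (a j)
    simpa using h1

/-- A version of Liouville's theorem for functions with bounded slices. -/
theorem eq_of_isBounded_range_update {V : ι → Type*} [∀ j, NormedAddCommGroup (V j)]
    [∀ j, NormedSpace ℂ (V j)] {A : ∀ j, Set (V j)} {F : (∀ j, V j) → ℂ} (hF : Differentiable ℂ F)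
    (hAo : ∀ j, IsOpen (A j))
    (hb : ∀ a ∈ Set.univ.pi A, ∀ j,
      Bornology.IsBounded (Set.range fun z => F (Function.update a j z)))
    {c : ∀ j, V j} (hc : c ∈ Set.univ.pi A) (z : ∀ j, V j) : F z = F c := by
  suffices h : ∀ T : Finset ι, ∀ a ∈ Set.univ.pi A, (∀ j ∉ T, a j = c j) → F a = F c by
    refine congrFun (Differentiable.eq_of_eventuallyEq_nhds (c := c) hF
      (differentiable_const (F c)) ?_) z
    filter_upwards [(isOpen_set_pi Set.finite_univ fun j _ => hAo j).mem_nhds hc] with a ha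
    exact h Finset.univ a ha fun j hj => absurd (Finset.mem_univ j) hj
  intro T
  induction T using Finset.induction_on with
  | empty => exact fun a _ h => congrArg F (funext fun j => h j (Finset.notMem_empty j))
  | insert j T hj ih =>
    intro a ha haT
    have h1 := (hF.comp (differentiable_function_update a j)).apply_eq_apply_of_bounded
      (hb a ha j) (a j) (c j)
    simp only [Function.comp_apply, Function.update_eq_self] at h1
    refine h1.trans (ih _ (Function.update_mem_univ_pi ha (hc j trivial)) fun i hi => ?_)
    rcases eq_or_ne i j with rfl | hij
    · simp
    · rw [Function.update_of_ne hij]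
      exact haT i (by simp [hij, hi])

end Cross

/-- Cross theorem for `(N,k)`-crosses in the case `D_j = ℂ^{n_j}` with `A_j` nonempty open:
every separately holomorphic function on the `(N,k)`-cross
`X_{N,k} = ⋃_{S ⊆ {1,…,N}, |S| = k} 𝒳_{1,α_1} × ⋯ × 𝒳_{N,α_N}` (with `𝒳_{j} = ℂ^{n_j}` for
`j ∈ S` and `𝒳_j = A_j` otherwise) extends uniquely to an entire function `F`, with
`sup |F| = sup_{X_{N,k}} |f|`. -/
theorem cross_theorem_Nk_entire (N : ℕ) (hN : 2 ≤ N) (k : ℕ) (hk1 : 1 ≤ k) (hkN : k ≤ N)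
    (n : Fin N → ℕ)
    (A : ∀ j, Set (Fin (n j) → ℂ)) (hAne : ∀ j, (A j).Nonempty) (hAo : ∀ j, IsOpen (A j))
    (X : Set (∀ j, Fin (n j) → ℂ))
    (hX : X = {z : ∀ j, Fin (n j) → ℂ |
      ∃ S : Finset (Fin N), S.card = k ∧ ∀ j ∉ S, z j ∈ A j})
    (f : (∀ j, Fin (n j) → ℂ) → ℂ)
    (hf : ∀ a ∈ Set.univ.pi A, ∀ S : Finset (Fin N), S.card = k →
      Differentiable ℂ
        (fun z : ∀ j, Fin (n j) → ℂ => f (fun j => if j ∈ S then z j else a j))) :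
    ∃ F : (∀ j, Fin (n j) → ℂ) → ℂ, Differentiable ℂ F ∧ Set.EqOn F f X ∧
      (⨆ z : ∀ j, Fin (n j) → ℂ, (‖F z‖₊ : ENNReal)) = (⨆ z ∈ X, (‖f z‖₊ : ENNReal)) ∧
      ∀ G : (∀ j, Fin (n j) → ℂ) → ℂ, Differentiable ℂ G → Set.EqOn G f X → G = F := by
  have hmemX : ∀ z, z ∈ X ↔ ∃ S : Finset (Fin N), S.card = k ∧ ∀ j ∉ S, z j ∈ A j :=
    fun z => hX ▸ Iff.rfl
  have hsup : ∀ j : Fin N, ∃ S : Finset (Fin N), j ∈ S ∧ S.card = k := by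
    intro j
    obtain ⟨S, hS, hcard⟩ := Finset.exists_superset_card_eq (s := {j}) (n := k)
      (by simpa using hk1) (by simpa using hkN)
    exact ⟨S, hS (Finset.mem_singleton_self j), hcard⟩
  have hslice : ∀ a ∈ Set.univ.pi A, ∀ j, Differentiable ℂ fun z => f (Function.update a j z) := by
    intro a ha j
    obtain ⟨S, hjS, hS⟩ := hsup j
    have h1 : (fun z => f (Function.update a j z)) =
        (fun z => f fun i => if i ∈ S then z i else a i) ∘ fun z => Function.update a j z := by
      funext z
      refine congrArg f (funext fun i => ?_)
      by_cases hi : i ∈ S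
      · simp [hi]
      · rw [if_neg hi, Function.update_of_ne (ne_of_mem_of_not_mem hjS hi).symm]
    rw [h1]
    exact (hf a ha S hS).comp (differentiable_function_update a j)
  have hAX : Set.univ.pi A ⊆ X := by
    intro a ha
    obtain ⟨S, -, hS⟩ := hsup ⟨0, by omega⟩
    exact (hmemX a).2 ⟨S, hS, fun j _ => ha j trivial⟩
  have hAopen : IsOpen (Set.univ.pi A) := isOpen_set_pi Set.finite_univ fun j _ => hAo j
  obtain ⟨c, hc⟩ := Set.univ_pi_nonempty_iff.2 hAne
  have hcA := hAopen.mem_nhds hc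
  obtain ⟨F, hF, hFc⟩ := exists_entire_eventuallyEq hAo hslice hc
  have hFA : Set.EqOn F f (Set.univ.pi A) := eqOn_univ_pi_of_eventuallyEq hAo
    (fun a _ j => hF.comp (differentiable_function_update a j)) hslice hc hFc
  have hFX : Set.EqOn F f X := by
    intro z hzX
    obtain ⟨S, hS, hz⟩ := (hmemX z).1 hzX
    set a : ∀ j, Fin (n j) → ℂ := fun j => if j ∈ S then c j else z j with ha_def
    have ha : a ∈ Set.univ.pi A := by
      intro j _
      by_cases hj : j ∈ S
      · simpa [ha_def, hj] using hc j trivial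
      · simpa [ha_def, hj] using hz j hj
    have hd : Differentiable ℂ fun (w : ∀ j, Fin (n j) → ℂ) j => if j ∈ S then w j else a j := by
      refine differentiable_pi.2 fun j => ?_
      by_cases hj : j ∈ S
      · simpa only [hj, if_true] using differentiable_apply j
      · simp only [hj, if_false, differentiable_const]
    have h1 := congrFun (Differentiable.eq_of_eventuallyEq_nhds (c := c) (hF.comp hd)
      (hf a ha S hS) (by
        filter_upwards [hcA] with w hw
        refine hFA fun j _ => ?_
        dsimp only
        split_ifs
        exacts [hw j trivial, ha j trivial])) z
    have h2 : (fun j => if j ∈ S then z j else a j) = z := by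
      funext j
      by_cases hj : j ∈ S <;> simp [ha_def, hj]
    simpa only [Function.comp_apply, h2] using h1
  refine ⟨F, hF, hFX, le_antisymm ?_ ?_, fun G hG hGf => ?_⟩
  · by_cases htop : (⨆ z ∈ X, (‖f z‖₊ : ENNReal)) = ⊤
    · exact htop ▸ le_top
    refine iSup_le fun z => ?_
    rw [eq_of_isBounded_range_update hF hAo (fun a ha j => ?_) hc z, hFA hc]
    · exact le_iSup₂_of_le c (hAX hc) le_rfl
    · refine isBounded_iff_forall_norm_le.2 ⟨(⨆ z ∈ X, (‖f z‖₊ : ENNReal)).toReal, ?_⟩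
      rintro _ ⟨w, rfl⟩
      obtain ⟨S, hjS, hS⟩ := hsup j
      have hw : Function.update a j w ∈ X :=
        (hmemX _).2 ⟨S, hS, fun i hi => by
          rw [Function.update_of_ne (ne_of_mem_of_not_mem hjS hi).symm]
          exact ha i trivial⟩
      have h1 := ENNReal.toReal_mono htop
        (le_iSup₂ (f := fun z _ => (‖f z‖₊ : ENNReal)) (Function.update a j w) hw)
      rw [← hFX hw] at h1
      simpa using h1
  · exact iSup₂_le fun z hz => hFX hz ▸ le_iSup (fun z => (‖F z‖₊ : ENNReal)) z
  · refine Differentiable.eq_of_eventuallyEq_nhds (c := c) hG hF ?_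
    filter_upwards [hcA] with a ha
    exact (hGf (hAX ha)).trans (hFX (hAX ha)).symm
end
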